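/- arXiv:1507.02124 — 2 statements merged into one kernel-verified Lean document; each statement's English description precedes it below -/
import Mathlib

section
/- Let γ > 0 and let R be a non-zero function on ℝ which is either (a) a rational function P/Q (P, Q complex polynomials, Q having no real zeros) or (b) a finite sum of complex exponentials R(x) = ∑_{j=1}^m c_j e^{λ_j x} with c_j, λ_j ∈ ℂ. Put g(x) = R(x) e^{−γx²}. If α, β > 0 are such that αβ is rational and αβ ≤ 1, then the Gabor system G(g, α, β) is complete in L²(ℝ). -/
open MeasureTheory Complex Real

/-- The Gabor system `G(g, α, β)` is complete in `L²(ℝ)`: the finite linear span of the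
time-frequency shifts `x ↦ e^{2πiβlx} g(x − αk)`, `k, l ∈ ℤ`, is dense in `L²(ℝ, ℂ)`. -/
def GaborComplete (g : ℝ → ℂ) (α β : ℝ) : Prop :=
  (Submodule.span ℂ {h : Lp ℂ 2 (volume : Measure ℝ) |
      ∃ k l : ℤ, ∀ᵐ x : ℝ, h x =
        Complex.exp (2 * Real.pi * Complex.I * (β * l * x)) * g (x - α * k)}).topologicalClosure
    = ⊤

theorem summable_exp_neg_sq_add {c : ℝ} (hc : 0 < c) (K : ℝ) :
    Summable fun n : ℤ => Real.exp (-c * n ^ 2 + K * |(n : ℝ)|) := by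
  have h := summable_pow_mul_jacobiTheta₂_term_bound (K / (2 * π)) (T := c / π) (by positivity) 0
  refine h.congr fun n => ?_
  have := Real.pi_pos.ne'
  simp only [pow_zero, one_mul, Int.cast_abs]
  congr 1
  field_simp
  ring

theorem hasSum_mul_prod_cosh_sub {c : ℤ → ℂ} {B : ℝ}
    (h : ∀ r : ℤ, HasSum (fun n : ℤ => c n * Real.exp (2 * B * r * n)) 0) (N : ℕ) (r : ℤ) :
    HasSum (fun n : ℤ => c n * Real.exp (2 * B * r * n) *
      ∏ j ∈ Finset.range N, ((2 * Real.cosh (2 * B * n) - 2 * Real.cosh (2 * B * (j + 1)) : ℝ) : ℂ))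
      0 := by
  induction N generalizing r with
  | zero => simpa using h r
  | succ N ih =>
    have := ((ih (r + 1)).add (ih (r - 1))).sub
      ((ih r).mul_left ((2 * Real.cosh (2 * B * (N + 1)) : ℝ) : ℂ))
    simp only [mul_zero, add_zero, sub_zero] at this
    refine (congrArg (HasSum · 0) (funext fun n => ?_)).mpr this
    rw [Finset.prod_range_succ, Real.cosh_eq (2 * B * n)]
    have e1 : Real.exp (2 * B * (r + 1 : ℤ) * n) =
        Real.exp (2 * B * r * n) * Real.exp (2 * B * n) := by
      rw [← Real.exp_add]; push_cast; ring_nf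
    have e2 : Real.exp (2 * B * (r - 1 : ℤ) * n) =
        Real.exp (2 * B * r * n) * Real.exp (-(2 * B * n)) := by
      rw [← Real.exp_add]; push_cast; ring_nf
    rw [e1, e2]
    push_cast
    ring

theorem eq_zero_of_gaussian_bound_zero {c : ℤ → ℂ} {A B C : ℝ} (hB : 0 < B) (hBA : B < A)
    (hc : ∀ n : ℤ, ‖c n‖ ≤ C * Real.exp (-A * n ^ 2))
    (h : ∀ r : ℤ, HasSum (fun n : ℤ => c n * Real.exp (2 * B * r * n)) 0) : c 0 = 0 := by
  set D := (A - B) / 2 with hD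
  have hDpos : 0 < D := by rw [hD]; linarith
  have hC : 0 ≤ C := by simpa using (norm_nonneg _).trans (hc 0)
  have hS : Summable fun n : ℤ => Real.exp (-D * n ^ 2) := by
    simpa using summable_exp_neg_sq_add hDpos 0
  set δ := (1 - Real.exp (-(2 * B))) ^ 2 with hδ
  have hδpos : 0 < δ := by
    have : Real.exp (-(2 * B)) < 1 := by rw [Real.exp_lt_one_iff]; linarith
    have : 0 < 1 - Real.exp (-(2 * B)) := by linarith
    positivity
  set q : ℤ → ℕ → ℝ := fun n j => 2 * Real.cosh (2 * B * n) - 2 * Real.cosh (2 * B * (j + 1))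
    with hq
  have hlow : ∀ j : ℕ, Real.exp (2 * B * (j + 1)) * δ ≤ |q 0 j| := by
    intro j
    have e1 : q 0 j = -(Real.exp (2 * B * (j + 1)) * (1 - Real.exp (-(2 * B * (j + 1)))) ^ 2) := by
      simp only [hq, Int.cast_zero, mul_zero, Real.cosh_eq, neg_zero, Real.exp_zero]
      have : Real.exp (2 * B * (j + 1)) * Real.exp (-(2 * B * (j + 1))) = 1 := by
        rw [← Real.exp_add]; simp
      linear_combination (-2 + Real.exp (-(2 * B * (j + 1)))) * this
    rw [e1, abs_neg, abs_of_nonneg (by positivity), hδ]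
    have h1 : Real.exp (-(2 * B)) < 1 := by rw [Real.exp_lt_one_iff]; linarith
    have h2 : Real.exp (-(2 * B * (j + 1))) ≤ Real.exp (-(2 * B)) := by
      apply Real.exp_le_exp.2
      have : 0 ≤ B * j := by positivity
      linarith
    gcongr
  have hup : ∀ (N : ℕ) (n : ℤ), n ≠ 0 →
      ‖c n * Real.exp (2 * B * (0 : ℤ) * n) * ∏ j ∈ Finset.range N, ((q n j : ℝ) : ℂ)‖ ≤
        C * Real.exp (B * N ^ 2 - D * N ^ 2) * Real.exp (-D * n ^ 2) := by
    intro N n hn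
    by_cases hnN : n.natAbs ≤ N
    · have : ∏ j ∈ Finset.range N, ((q n j : ℝ) : ℂ) = 0 := by
        refine Finset.prod_eq_zero (i := n.natAbs - 1) ?_ ?_
        · simp; omega
        · have h3 : ((n.natAbs - 1 : ℕ) : ℝ) + 1 = |(n : ℝ)| := by
            have : 1 ≤ n.natAbs := by omega
            push_cast [this]
            simp [Nat.cast_natAbs]
          simp only [hq, h3]
          rcases abs_cases (n : ℝ) with h4 | h4 <;> simp [h4.1, -abs_eq_self, -abs_eq_neg_self]
      rw [this, mul_zero, norm_zero]
      positivity
    · have hnN' : (N : ℝ) ≤ |(n : ℝ)| := by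
        have : N ≤ n.natAbs := by omega
        rw [← Int.cast_abs, ← Nat.cast_natAbs]
        simpa using (Nat.cast_le (α := ℝ)).2 this
      have hprod : ‖∏ j ∈ Finset.range N, ((q n j : ℝ) : ℂ)‖ ≤
          Real.exp (2 * B * |(n : ℝ)|) ^ N := by
        rw [norm_prod]
        refine (Finset.prod_le_prod (fun _ _ => norm_nonneg _)
          (g := fun _ => Real.exp (2 * B * |(n : ℝ)|)) ?_).trans (by simp)
        intro j hj
        have hj' : (j : ℝ) + 1 ≤ |(n : ℝ)| := by
          have : j + 1 ≤ N := by simpa using hj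
          have : (j : ℝ) + 1 ≤ N := by exact_mod_cast this
          linarith
        have e2 : q n j = 2 * Real.cosh (2 * B * |(n : ℝ)|) - 2 * Real.cosh (2 * B * (j + 1)) := by
          simp only [hq]
          rcases abs_cases (n : ℝ) with h4 | h4 <;> simp [h4.1, -abs_eq_self, -abs_eq_neg_self]
        have h5 : Real.cosh (2 * B * (j + 1)) ≤ Real.cosh (2 * B * |(n : ℝ)|) := by
          rw [Real.cosh_le_cosh, abs_of_nonneg (by positivity), abs_of_nonneg (by positivity)]
          gcongr
        have h6 : 1 ≤ Real.cosh (2 * B * (j + 1)) := Real.one_le_cosh _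
        have h7 : Real.exp (-(2 * B * |(n : ℝ)|)) ≤ 1 := by
          rw [Real.exp_le_one_iff]
          have : 0 ≤ B * |(n : ℝ)| := by positivity
          linarith
        rw [Complex.norm_real, Real.norm_eq_abs, abs_of_nonneg (by rw [e2]; linarith), e2,
          Real.cosh_eq (2 * B * |(n : ℝ)|)]
        linarith
      simp only [Int.cast_zero, mul_zero, zero_mul, Real.exp_zero, Complex.ofReal_one, mul_one,
        norm_mul]
      calc ‖c n‖ * ‖∏ j ∈ Finset.range N, ((q n j : ℝ) : ℂ)‖
          ≤ C * Real.exp (-A * n ^ 2) * Real.exp (2 * B * |(n : ℝ)|) ^ N := by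
            gcongr; exact hc n
        _ = C * Real.exp (-A * n ^ 2 + N * (2 * B * |(n : ℝ)|)) := by
            rw [← Real.exp_nat_mul, Real.exp_add]; ring
        _ ≤ C * Real.exp (B * N ^ 2 - D * N ^ 2 + -D * n ^ 2) := by
            refine mul_le_mul_of_nonneg_left (Real.exp_le_exp.2 ?_) hC
            have e3 : (n : ℝ) ^ 2 = |(n : ℝ)| ^ 2 := (sq_abs _).symm
            have e4 : A = B + 2 * D := by rw [hD]; ring
            rw [e3, e4]
            have h8 : (N : ℝ) ^ 2 ≤ |(n : ℝ)| ^ 2 := by gcongr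
            nlinarith [mul_nonneg hB.le (sq_nonneg (|(n : ℝ)| - N)),
              mul_le_mul_of_nonneg_left h8 hDpos.le]
        _ = _ := by rw [Real.exp_add]; ring
  set S := ∑' n : ℤ, Real.exp (-D * n ^ 2) with hSdef
  have key : ∀ N : ℕ, ‖c 0‖ ≤ C * S * (Real.exp (-D * N ^ 2) * (δ⁻¹) ^ N) := by
    intro N
    have hsum := hasSum_mul_prod_cosh_sub h N 0
    set t : ℤ → ℂ := fun n => c n * Real.exp (2 * B * (0 : ℤ) * n) *
      ∏ j ∈ Finset.range N, ((q n j : ℝ) : ℂ) with ht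
    change HasSum t 0 at hsum
    have h9 : ‖t 0‖ ≤ C * Real.exp (B * N ^ 2 - D * N ^ 2) * S := by
      have h10 := hsum.update 0 0
      have h11 := hsum.sub h10
      have h12 : HasSum (Function.update t 0 0) (0 - t 0 + 0) := by
        simpa [add_comm, sub_eq_add_neg] using h10
      have h13 := (hS.hasSum.mul_left (C * Real.exp (B * N ^ 2 - D * N ^ 2)))
      have h14 := h12.norm_le_of_bounded h13 (fun n => by
        by_cases hn : n = 0
        · subst hn
          simp only [Function.update_self, norm_zero]; positivity
        · rw [Function.update_of_ne hn]; exact hup N n hn)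
      rwa [zero_sub, add_zero, norm_neg] at h14
    have h15 : ‖c 0‖ * (Real.exp (B * N ^ 2) * δ ^ N) ≤ ‖t 0‖ := by
      simp only [ht, Int.cast_zero, mul_zero, zero_mul, Real.exp_zero, Complex.ofReal_one, mul_one,
        norm_mul, norm_prod, Complex.norm_real, Real.norm_eq_abs]
      gcongr
      calc Real.exp (B * N ^ 2) * δ ^ N
          ≤ ∏ j ∈ Finset.range N, (Real.exp (2 * B * (j + 1)) * δ) := by
            rw [Finset.prod_mul_distrib, ← Real.exp_sum]
            simp only [Finset.prod_const, Finset.card_range]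
            gcongr
            clear_value q t S
            clear * - hB
            induction N with
            | zero => simp
            | succ N ih => rw [Finset.sum_range_succ]; push_cast; nlinarith
        _ ≤ _ := Finset.prod_le_prod (fun _ _ => by positivity) fun j _ => hlow j
    have h16 := h15.trans h9
    have h17 : 0 < Real.exp (B * N ^ 2) * δ ^ N := by positivity
    rw [← le_div_iff₀ h17] at h16
    refine h16.trans (le_of_eq ?_)
    rw [sub_eq_add_neg, Real.exp_add, ← neg_mul, inv_pow]
    field_simp
  have hlim : Filter.Tendsto (fun N : ℕ => C * S * (Real.exp (-D * N ^ 2) * (δ⁻¹) ^ N))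
      Filter.atTop (nhds (C * S * 0)) := by
    refine Filter.Tendsto.const_mul _ ?_
    have hs := summable_exp_neg_sq_add hDpos (Real.log δ⁻¹)
    have hs2 : Summable fun n : ℕ => Real.exp (-D * n ^ 2 + Real.log δ⁻¹ * n) := by
      simpa [Function.comp_def] using hs.comp_injective Nat.cast_injective
    refine hs2.tendsto_atTop_zero.congr fun n => ?_
    rw [Real.exp_add, mul_comm (Real.log _), Real.exp_nat_mul, Real.exp_log (by positivity)]
  rw [mul_zero] at hlim
  have := ge_of_tendsto hlim (Filter.Eventually.of_forall key)
  exact norm_le_zero_iff.1 this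

theorem eq_zero_of_gaussian_bound {c : ℤ → ℂ} {A B C : ℝ} (hB : 0 < B) (hBA : B < A)
    (hc : ∀ n : ℤ, ‖c n‖ ≤ C * Real.exp (-A * n ^ 2))
    (h : ∀ r : ℤ, HasSum (fun n : ℤ => c n * Real.exp (2 * B * r * n)) 0) (m : ℤ) : c m = 0 := by
  have hC : 0 ≤ C := by simpa using (norm_nonneg _).trans (hc 0)
  set D := (A - B) / 2 with hD
  have hDpos : 0 < D := by rw [hD]; linarith
  have h0 := eq_zero_of_gaussian_bound_zero (c := fun n => c (n + m)) (A := A - D)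
    (C := C * Real.exp (A ^ 2 * m ^ 2 / D - A * m ^ 2)) hB (by linarith) ?_ ?_
  · simpa using h0
  · intro n
    refine (hc _).trans ?_
    rw [mul_assoc, ← Real.exp_add]
    gcongr
    push_cast
    have : A ^ 2 * m ^ 2 / D - A * m ^ 2 + -(A - D) * n ^ 2 - -A * ((n : ℝ) + m) ^ 2
      = (A * m + D * n) ^ 2 / D := by field_simp; ring
    have h2 : 0 ≤ (A * m + D * n) ^ 2 / D := by positivity
    linarith
  · intro r
    have h1 := (Equiv.hasSum_iff (Equiv.addRight m)).2 (h r)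
    have h2 := h1.mul_right ((Real.exp (-(2 * B * r * m)) : ℝ) : ℂ)
    rw [zero_mul] at h2
    refine (congrArg (HasSum · 0) (funext fun n => ?_)).mpr h2
    simp only [Function.comp_apply, Equiv.coe_addRight]
    rw [mul_assoc (c (n + m)), ← Complex.ofReal_mul, ← Real.exp_add]
    push_cast
    ring_nf

theorem hasSum_int_of_residues {p : ℕ} [NeZero p] {f : ℤ → ℂ} {S : Fin p → ℂ}
    (h : ∀ s : Fin p, HasSum (fun m : ℤ => f (p * m + (s : ℕ))) (S s)) : HasSum f (∑ s, S s) := by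
  have hp : (p : ℤ) ≠ 0 := by exact_mod_cast NeZero.ne p
  have h1 : ∀ s : Fin p, HasSum (fun n : ℤ => if n % p = (s : ℕ) then f n else 0) (S s) := by
    intro s
    have hinj : Function.Injective fun m : ℤ => (p : ℤ) * m + (s : ℕ) := fun x y hxy => by
      simpa [NeZero.ne p] using hxy
    have hs : ((s : ℕ) : ℤ) % p = (s : ℕ) :=
      Int.emod_eq_of_lt (by positivity) (by exact_mod_cast s.2)
    rw [← hinj.hasSum_iff]
    · convert h s using 2 with m
      simp [Int.add_emod, hs]
    · intro n hn
      rw [if_neg]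
      intro hns
      refine hn ⟨n / p, ?_⟩
      simp only
      rw [← hns, Int.mul_ediv_add_emod]
  have h2 := hasSum_sum (s := Finset.univ) fun s _ => h1 s
  refine (congrArg (HasSum · (∑ s, S s)) (funext fun n => ?_)).mpr h2
  have hlt : (n % p).toNat < p := by
    have := Int.emod_lt_of_pos n (b := p) (by positivity)
    have := Int.emod_nonneg n hp
    omega
  rw [Finset.sum_eq_single (⟨(n % p).toNat, hlt⟩ : Fin p)]
  · simp [Int.emod_nonneg n hp]
  · intro s _ hs
    rw [if_neg]
    intro h3
    apply hs
    ext
    simp [h3]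
  · simp

theorem summable_exp_neg_sq_affine {γ c : ℝ} (hγ : 0 < γ) (hc : 0 < c) (K L d : ℝ) :
    Summable fun m : ℤ => Real.exp (K * |c * m + d| - γ * (c * m + d) ^ 2 + L * |(m : ℝ)|) := by
  have h := summable_exp_neg_sq_add (c := γ * c ^ 2) (by positivity)
    (|K| * c + 2 * γ * c * |d| + L)
  refine Summable.of_nonneg_of_le (fun _ => (Real.exp_pos _).le) (fun m => ?_)
    (h.mul_left (Real.exp (|K| * |d|)))
  rw [← Real.exp_add]
  apply Real.exp_le_exp.2
  have h1 : K * |c * m + d| ≤ |K| * (c * |(m : ℝ)| + |d|) := by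
    have : |c * m + d| ≤ c * |(m : ℝ)| + |d| := by
      have := abs_add_le (c * m) d
      rwa [abs_mul, abs_of_pos hc] at this
    have h2 := le_abs_self K
    exact mul_le_mul h2 this (abs_nonneg _) (abs_nonneg _)
  have h3 : -(m * d) ≤ |(m : ℝ)| * |d| := by rw [← abs_mul]; exact neg_le_abs _
  have h4 : 0 ≤ γ * d ^ 2 := by positivity
  have h5 := mul_le_mul_of_nonneg_left h3 (by positivity : 0 ≤ 2 * γ * c)
  nlinarith

theorem gaussian_periodization_injective {γ b α : ℝ} (hγ : 0 < γ) (hb : 0 < b) (hα : 0 < α)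
    {p q : ℕ} (hp : 0 < p) (hpq : p ≤ q) (hco : p.Coprime q) (hαb : α * q = b * p)
    {v : Fin p → ℂ}
    (hv : ∀ r : Fin q, ∑ s, v s *
      ∑' m : ℤ, (Real.exp (-γ * (b * (p * m + (s : ℕ)) - r * α) ^ 2) : ℂ) = 0) : v = 0 := by
  have : NeZero p := ⟨hp.ne'⟩
  have hq : 0 < q := hp.trans_le hpq
  have hpR : (0 : ℝ) < p := by exact_mod_cast hp
  have hsum : ∀ (s : ℕ) (k : ℝ),
      Summable fun m : ℤ => Real.exp (-γ * (b * (p * m + s) - k * α) ^ 2) := fun s k => by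
    have := summable_exp_neg_sq_affine hγ (mul_pos hb hpR) 0 0 (b * s - k * α)
    refine this.congr fun m => ?_
    ring_nf
  rcases hpq.eq_or_lt with rfl | hlt
  · have hp1 : p = 1 := by simpa using hco
    subst hp1
    have h0 := hv 0
    simp only [Finset.univ_unique, Finset.sum_singleton, mul_eq_zero] at h0
    rcases h0 with h0 | h0
    · ext s; rw [Subsingleton.elim s default]; exact h0
    · exfalso
      rw [← Complex.ofReal_tsum, Complex.ofReal_eq_zero] at h0
      exact ((hsum _ _).tsum_pos (fun _ => (Real.exp_pos _).le) 0 (Real.exp_pos _)).ne' h0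
  have hab : α < b := by
    have : (p : ℝ) < q := by exact_mod_cast hlt
    by_contra! hcon
    have : b * p < α * q := by
      calc b * p ≤ α * p := by gcongr
        _ < α * q := by gcongr
    linarith
  have hpz : (p : ℤ) ≠ 0 := by exact_mod_cast hp.ne'
  have hmod : ∀ n : ℤ, (n % p).toNat < p := fun n => by
    have := Int.emod_lt_of_pos n (b := p) (by positivity)
    have := Int.emod_nonneg n hpz
    omega
  set w : ℤ → ℂ := fun n => v ⟨(n % p).toNat, hmod n⟩ with hw
  have hwv : ∀ (s : Fin p) (m : ℤ), w (p * m + (s : ℕ)) = v s := fun s m => by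
    have hs : ((s : ℕ) : ℤ) % p = (s : ℕ) :=
      Int.emod_eq_of_lt (by positivity) (by exact_mod_cast s.2)
    simp only [hw]
    congr 1
    ext
    simp [Int.add_emod, hs]
  have hk : ∀ k : ℤ,
      HasSum (fun n : ℤ => w n * (Real.exp (-γ * (b * n - k * α) ^ 2) : ℂ)) 0 := by
    intro k
    have hqz : (q : ℤ) ≠ 0 := by exact_mod_cast hq.ne'
    have hrlt : (k % q).toNat < q := by
      have := Int.emod_lt_of_pos k (b := q) (by positivity)
      have := Int.emod_nonneg k hqz
      omega
    rw [← hv ⟨(k % q).toNat, hrlt⟩]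
    apply hasSum_int_of_residues
    intro s
    simp only [hwv]
    apply HasSum.mul_left
    have h1 := (Complex.hasSum_ofReal.2 (hsum s (k % q).toNat).hasSum)
    rw [Complex.ofReal_tsum] at h1
    have h2 := (Equiv.hasSum_iff (Equiv.subRight (k / q))).2 h1
    refine (congrArg (HasSum · _) (funext fun n => ?_)).mpr h2
    simp only [Function.comp_apply, Equiv.subRight_apply]
    have h3 : (((k % q).toNat : ℕ) : ℝ) = k - q * ((k / q : ℤ) : ℝ) := by
      have h4 : (((k % q).toNat : ℕ) : ℤ) = k - q * (k / q) := by
        rw [Int.toNat_of_nonneg (Int.emod_nonneg k hqz), Int.emod_def]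
      exact_mod_cast congrArg (Int.cast : ℤ → ℝ) h4
    rw [h3]
    congr 4
    push_cast
    linear_combination -((k / q : ℤ) : ℝ) * hαb
  obtain ⟨C, hC⟩ : ∃ C, ∀ s, ‖v s‖ ≤ C :=
    ⟨∑ s, ‖v s‖, fun s => Finset.single_le_sum (f := fun s => ‖v s‖)
      (fun _ _ => norm_nonneg _) (Finset.mem_univ s)⟩
  have key := eq_zero_of_gaussian_bound (c := fun n => w n * Real.exp (-γ * b ^ 2 * n ^ 2))
    (A := γ * b ^ 2) (B := γ * b * α) (C := C) (by positivity)
    (by rw [pow_two, ← mul_assoc]; gcongr) (fun n => by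
      rw [norm_mul, Complex.norm_real, Real.norm_eq_abs, Real.abs_exp, neg_mul]
      gcongr
      exact hC _) (fun k => by
      have := (hk k).mul_right ((Real.exp (γ * (k * α) ^ 2) : ℝ) : ℂ)
      rw [zero_mul] at this
      refine (congrArg (HasSum · 0) (funext fun n => ?_)).mpr this
      rw [mul_assoc, mul_assoc (w n), ← Complex.ofReal_mul, ← Complex.ofReal_mul, ← Real.exp_add,
        ← Real.exp_add]
      ring_nf)
  ext s
  have := key (s : ℕ)
  have h5 := hwv s 0
  simp only [mul_zero, zero_add] at h5
  simpa [h5] using this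

theorem ae_ne_zero_of_differentiableOn {f : ℂ → ℂ} {U : Set ℂ} (hU : IsOpen U)
    (hUc : IsPreconnected U) (hUr : ∀ x : ℝ, (x : ℂ) ∈ U) (hf : DifferentiableOn ℂ f U) {z₀ : ℂ}
    (hz₀ : z₀ ∈ U) (hne : f z₀ ≠ 0) : ∀ᵐ x : ℝ, f x ≠ 0 := by
  have han : AnalyticOnNhd ℂ f U := hf.analyticOnNhd hU
  have hreal : AnalyticOnNhd ℝ (fun x : ℝ => f x) Set.univ := fun x _ =>
    ((han x (hUr x)).restrictScalars (𝕜 := ℝ)).comp (Complex.ofRealCLM.analyticAt x)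
  rcases hreal.eqOn_zero_or_eventually_ne_zero_of_preconnected isPreconnected_univ with h | h
  · exfalso
    refine hne (han.eqOn_zero_of_preconnected_of_frequently_eq_zero hUc (hUr 0) ?_ hz₀)
    have hinj : Filter.Tendsto (fun x : ℝ => (x : ℂ)) (nhdsWithin 0 {0}ᶜ)
        (nhdsWithin ((0 : ℝ) : ℂ) {((0 : ℝ) : ℂ)}ᶜ) := by
      refine tendsto_nhdsWithin_iff.2
        ⟨(Complex.continuous_ofReal.tendsto 0).mono_left nhdsWithin_le_nhds, ?_⟩
      filter_upwards [self_mem_nhdsWithin] with x hx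
      simpa using hx
    exact hinj.frequently (Filter.Frequently.of_forall fun x => h (Set.mem_univ x))
  · have := ae_restrict_le_codiscreteWithin (μ := volume) (U := (Set.univ : Set ℝ))
      MeasurableSet.univ h
    rwa [Measure.restrict_univ] at this

theorem ae_addCircle_of_ae_real {P : AddCircle (1 : ℝ) → Prop}
    (h : ∀ᵐ x : ℝ, P (x : AddCircle (1 : ℝ))) : ∀ᵐ ω : AddCircle (1 : ℝ), P ω := by
  have h1 := (AddCircle.measurePreserving_equivIoc (T := (1 : ℝ)) (a := 0)).quasiMeasurePreserving
  have h2 : ∀ᵐ y : Set.Ioc (0 : ℝ) (0 + 1) ∂(Measure.comap Subtype.val volume),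
      P ((y : ℝ) : AddCircle (1 : ℝ)) := by
    rw [ae_iff] at h ⊢
    rw [comap_subtype_coe_apply measurableSet_Ioc]
    exact measure_mono_null (by rintro _ ⟨y, hy, rfl⟩; exact hy) h
  filter_upwards [h1.ae h2] with ω hω
  simpa using hω

/-- A function on a horizontally invariant domain, of at most exponential growth, which along the
sequence `x` and up to normalization is asymptotic to `a ↦ exp (lam * a)`. -/
structure IsTameAlong (U : Set ℂ) (x : ℕ → ℂ) (lam : ℂ) (R : ℂ → ℂ) : Prop where
  differentiableOn : DifferentiableOn ℂ R U
  growth : ∃ C A : ℝ, ∀ z ∈ U, ‖R z‖ ≤ C * Real.exp (A * ‖z‖)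
  asymptotic : ∃ N : ℕ → ℂ,
    (∀ a : ℝ, Filter.Tendsto (fun n => R (x n + a) / N n) Filter.atTop
      (nhds (Complex.exp (lam * a)))) ∧
    ∃ C A : ℝ, ∀ᶠ n in Filter.atTop, ∀ a : ℝ, ‖R (x n + a) / N n‖ ≤ C * Real.exp (A * |a|)

theorem norm_exp_gaussian_le (γ a : ℝ) (m : ℤ) {ζ : ℂ} {L : ℝ} (hζ : ‖ζ‖ ≤ L) :
    ‖Complex.exp (-γ * a ^ 2 + ζ * m)‖ ≤ Real.exp (-γ * a ^ 2 + L * |(m : ℝ)|) := by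
  rw [Complex.norm_exp]
  apply Real.exp_le_exp.2
  have h4 : (ζ * m).re ≤ L * |(m : ℝ)| := (Complex.re_le_norm _).trans (by
    rw [norm_mul, Complex.norm_intCast]; gcongr)
  have h5 : (-γ * (a : ℂ) ^ 2).re = -γ * a ^ 2 := by
    rw [← Complex.ofReal_pow, ← Complex.ofReal_neg, ← Complex.ofReal_mul, Complex.ofReal_re]
  rw [Complex.add_re, h5]
  linarith

section GenericRank

variable {U : Set ℂ} {x : ℕ → ℂ} {lam : ℂ} {R : ℂ → ℂ}

theorem IsTameAlong.norm_term_le (hR : IsTameAlong U x lam R)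
    (hUadd : ∀ z ∈ U, ∀ a : ℝ, z + a ∈ U) :
    ∃ C A : ℝ, 0 ≤ C ∧ 0 ≤ A ∧ ∀ (γ : ℝ) (m : ℤ) (B L : ℝ), ∀ z ∈ U, ‖z‖ ≤ B → ∀ ζ : ℂ, ‖ζ‖ ≤ L →
      ∀ a : ℝ, ‖R (z + a) * Complex.exp (-γ * a ^ 2 + ζ * m)‖ ≤
        C * Real.exp (A * B) * Real.exp (A * |a| - γ * a ^ 2 + L * |(m : ℝ)|) := by
  obtain ⟨C, A, h⟩ := hR.growth
  refine ⟨|C|, |A|, abs_nonneg _, abs_nonneg _, fun γ m B L z hz hzB ζ hζ a => ?_⟩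
  have h1 : ‖R (z + a)‖ ≤ |C| * Real.exp (|A| * (B + |a|)) := by
    refine (h _ (hUadd z hz a)).trans ?_
    have : ‖z + a‖ ≤ B + |a| := (norm_add_le _ _).trans (by
      rw [Complex.norm_real, Real.norm_eq_abs]; gcongr)
    have h2 : A * ‖z + a‖ ≤ |A| * (B + |a|) :=
      mul_le_mul (le_abs_self A) this (norm_nonneg _) (abs_nonneg _)
    gcongr
    exact le_abs_self C
  have h3 := norm_exp_gaussian_le γ a m hζ
  rw [norm_mul]
  calc _ ≤ |C| * Real.exp (|A| * (B + |a|)) * Real.exp (-γ * a ^ 2 + L * |(m : ℝ)|) := by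
        gcongr
    _ = _ := by
        rw [mul_assoc, mul_assoc, ← Real.exp_add, ← Real.exp_add]
        ring_nf

/-- The series `∑ₘ R (z + c m + d) exp (-γ (c m + d)² + ζ m)`. -/
noncomputable def gaussSeries (R : ℂ → ℂ) (γ c d : ℝ) (z ζ : ℂ) : ℂ :=
  ∑' m : ℤ, R (z + (c * m + d : ℝ)) * Complex.exp (-γ * (c * m + d : ℝ) ^ 2 + ζ * m)

theorem IsTameAlong.differentiableOn_gaussSeries_left (hR : IsTameAlong U x lam R)
    (hU : IsOpen U) (hUadd : ∀ z ∈ U, ∀ a : ℝ, z + a ∈ U) {γ c : ℝ} (hγ : 0 < γ) (hc : 0 < c)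
    (d : ℝ) (ζ : ℂ) : DifferentiableOn ℂ (fun z => gaussSeries R γ c d z ζ) U := by
  obtain ⟨C, A, hC, hA, h⟩ := hR.norm_term_le hUadd
  intro z hz
  have hV : IsOpen (U ∩ Metric.ball 0 (‖z‖ + 1)) := hU.inter Metric.isOpen_ball
  have hd : DifferentiableOn ℂ (fun z => gaussSeries R γ c d z ζ)
      (U ∩ Metric.ball 0 (‖z‖ + 1)) := by
    refine differentiableOn_tsum_of_summable_norm
      ((summable_exp_neg_sq_affine hγ hc A ‖ζ‖ d).mul_left (C * Real.exp (A * (‖z‖ + 1))))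
      (fun m => ?_) hV (fun m w hw => ?_)
    · refine DifferentiableOn.mul_const ?_ _
      refine hR.differentiableOn.comp (differentiableOn_id.add_const _) ?_
      exact fun w hw => hUadd w hw.1 _
    · exact h γ m _ _ w hw.1 (by simpa using (Metric.mem_ball.1 hw.2).le) ζ le_rfl _
  exact (hd.differentiableAt (hV.mem_nhds ⟨hz, by simp⟩)).differentiableWithinAt

theorem IsTameAlong.differentiable_gaussSeries_right (hR : IsTameAlong U x lam R)
    (hUadd : ∀ z ∈ U, ∀ a : ℝ, z + a ∈ U) {γ c : ℝ} (hγ : 0 < γ) (hc : 0 < c)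
    (d : ℝ) {z : ℂ} (hz : z ∈ U) : Differentiable ℂ (fun ζ => gaussSeries R γ c d z ζ) := by
  obtain ⟨C, A, hC, hA, h⟩ := hR.norm_term_le hUadd
  intro ζ
  have hd : DifferentiableOn ℂ (fun ζ => gaussSeries R γ c d z ζ) (Metric.ball 0 (‖ζ‖ + 1)) := by
    refine differentiableOn_tsum_of_summable_norm
      ((summable_exp_neg_sq_affine hγ hc A (‖ζ‖ + 1) d).mul_left (C * Real.exp (A * ‖z‖)))
      (fun m => ?_) Metric.isOpen_ball (fun m w hw => ?_)
    · fun_prop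
    · exact h γ m _ _ z hz le_rfl w (by simpa using (Metric.mem_ball.1 hw).le) _
  exact hd.differentiableAt (Metric.isOpen_ball.mem_nhds (by simp))

theorem IsTameAlong.tendsto_gaussSeries (hR : IsTameAlong U x lam R) :
    ∃ N : ℕ → ℂ, ∀ {γ c : ℝ}, 0 < γ → 0 < c → ∀ (d : ℝ),
      Filter.Tendsto (fun n => gaussSeries R γ c d (x n) (-lam * c) / N n) Filter.atTop
        (nhds (Complex.exp (lam * d) * ∑' m : ℤ, (Real.exp (-γ * (c * m + d) ^ 2) : ℂ))) := by
  obtain ⟨N, hN, C, A, hb⟩ := hR.asymptotic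
  refine ⟨N, fun {γ c} hγ hc d => ?_⟩
  have hlim : ∀ m : ℤ, Complex.exp (lam * (c * m + d : ℝ)) *
      Complex.exp (-γ * (c * m + d : ℝ) ^ 2 + -lam * c * m) =
      Complex.exp (lam * d) * (Real.exp (-γ * (c * m + d) ^ 2) : ℂ) := fun m => by
    push_cast
    rw [← Complex.exp_add, ← Complex.exp_add]
    ring_nf
  rw [← tsum_mul_left]
  simp_rw [← hlim, gaussSeries, ← tsum_div_const]
  refine tendsto_tsum_of_dominated_convergence
    (bound := fun m : ℤ => C * Real.exp (A * |c * m + d| - γ * (c * m + d) ^ 2 +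
      ‖-lam * c‖ * |(m : ℝ)|))
    ((summable_exp_neg_sq_affine hγ hc A ‖-lam * c‖ d).mul_left C) (fun m => ?_) ?_
  · have := (hN (c * m + d : ℝ)).mul_const
      (Complex.exp (-γ * (c * m + d : ℝ) ^ 2 + -lam * c * m))
    refine this.congr fun n => ?_
    ring
  · filter_upwards [hb] with n hn m
    rw [mul_div_right_comm, norm_mul]
    have h1 := hn (c * m + d)
    have h2 := norm_exp_gaussian_le γ (c * m + d) m (le_refl ‖-lam * c‖)
    refine (mul_le_mul h1 h2 (norm_nonneg _) ((norm_nonneg _).trans h1)).trans (le_of_eq ?_)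
    rw [mul_assoc, ← Real.exp_add]
    ring_nf

open Matrix ComplexOrder in
theorem IsTameAlong.ae_injective (hR : IsTameAlong U x lam R) (hU : IsOpen U)
    (hUc : IsPreconnected U) (hU0 : 0 ∈ U) (hUadd : ∀ z ∈ U, ∀ a : ℝ, z + a ∈ U)
    (hx : ∀ n, x n ∈ U) {γ b α : ℝ} (hγ : 0 < γ) (hb : 0 < b) (hα : 0 < α)
    {p q : ℕ} (hp : 0 < p) (hpq : p ≤ q) (hco : p.Coprime q) (hαb : α * q = b * p) :
    ∀ᵐ y : ℝ, ∀ᵐ ω : AddCircle (1 : ℝ), ∀ v : Fin p → ℂ,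
      (∀ r : Fin q, ∑ s : Fin p, v s * ∑' m : ℤ,
        (R ((y + (b * (p * m + (s : ℕ)) - r * α) : ℝ) : ℂ) *
          Complex.exp (-γ * (y + (b * (p * m + (s : ℕ)) - r * α) : ℝ) ^ 2)) *
            fourier (-m) ω = 0) → v = 0 := by
  have hc : 0 < b * p := by have : (0 : ℝ) < p := by exact_mod_cast hp
                            positivity
  have hUr : ∀ y : ℝ, (y : ℂ) ∈ U := fun y => by simpa using hUadd 0 hU0 y
  set T : ℂ → ℂ → Matrix (Fin q) (Fin p) ℂ := fun z ζ => Matrix.of fun r s =>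
    gaussSeries R γ (b * p) (b * (s : ℕ) - r * α) z ζ with hT
  set G : Matrix (Fin q) (Fin p) ℂ := Matrix.of fun r s =>
    Complex.exp (lam * (b * (s : ℕ) - r * α : ℝ)) *
      ∑' m : ℤ, (Real.exp (-γ * (b * p * m + (b * (s : ℕ) - r * α)) ^ 2) : ℂ) with hG
  have hGinj : ∀ v, G *ᵥ v = 0 → v = 0 := by
    intro v hv
    have h1 := gaussian_periodization_injective hγ hb hα hp hpq hco hαb
      (v := fun s => v s * Complex.exp (lam * b * (s : ℕ))) (fun r => by
        have h2 := congrFun hv r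
        simp only [Matrix.mulVec, dotProduct, hG, Matrix.of_apply, Pi.zero_apply] at h2
        have h3 := congrArg (Complex.exp (lam * (r * α)) * ·) h2
        simp only [mul_zero, Finset.mul_sum] at h3
        rw [← h3]
        refine Finset.sum_congr rfl fun s _ => ?_
        have h4 : Complex.exp (lam * b * (s : ℕ)) =
            Complex.exp (lam * (r * α)) * Complex.exp (lam * (b * (s : ℕ) - r * α : ℝ)) := by
          rw [← Complex.exp_add]; push_cast; ring_nf
        have h5 : ∀ m : ℤ, b * (p * m + (s : ℕ)) - r * α =
          b * p * m + (b * (s : ℕ) - r * α) := fun m => by ring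
        simp only [h4, h5]
        ring)
    ext s
    simpa using congrFun h1 s
  have hdetG : (Gᴴ * G).det ≠ 0 := by
    intro h0
    obtain ⟨v, hv, h⟩ := Matrix.exists_mulVec_eq_zero_iff.2 h0
    exact hv (hGinj v ((Matrix.conjTranspose_mul_self_mulVec_eq_zero G v).1 h))
  set E : ℂ → ℂ → ℂ := fun z ζ => (Gᴴ * T z ζ).det with hE
  have hE1 : ∀ ζ, DifferentiableOn ℂ (fun z => E z ζ) U := fun ζ => by
    simp only [hE, Matrix.det_apply', Matrix.mul_apply, hT, Matrix.of_apply]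
    refine DifferentiableOn.fun_sum fun σ _ => DifferentiableOn.const_mul ?_ _
    refine DifferentiableOn.fun_finsetProd fun i _ => ?_
    refine DifferentiableOn.fun_sum fun r _ => DifferentiableOn.const_mul ?_ _
    exact hR.differentiableOn_gaussSeries_left hU hUadd hγ hc _ _
  have hE2 : ∀ z ∈ U, Differentiable ℂ (fun ζ => E z ζ) := fun z hz => by
    simp only [hE, Matrix.det_apply', Matrix.mul_apply, hT, Matrix.of_apply]
    refine Differentiable.fun_sum fun σ _ => Differentiable.const_mul ?_ _
    refine Differentiable.fun_finsetProd fun i _ => ?_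
    refine Differentiable.fun_sum fun r _ => Differentiable.const_mul ?_ _
    exact hR.differentiable_gaussSeries_right hUadd hγ hc _ hz
  set ζ₀ : ℂ := -lam * (b * p : ℝ) with hζ₀
  obtain ⟨n, hn⟩ : ∃ n, E (x n) ζ₀ ≠ 0 := by
    obtain ⟨N, hN⟩ := hR.tendsto_gaussSeries
    have hTG : Filter.Tendsto (fun n => (N n)⁻¹ • T (x n) ζ₀) Filter.atTop (nhds G) := by
      refine tendsto_pi_nhds.2 fun r => tendsto_pi_nhds.2 fun s => ?_
      have := hN hγ hc (b * (s : ℕ) - r * α)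
      simp only [hG, Matrix.of_apply]
      refine (this.congr fun n => ?_).trans (le_of_eq ?_)
      · simp [hT, hζ₀, div_eq_inv_mul]
      · simp
    have hdet : Filter.Tendsto (fun n => (Gᴴ * ((N n)⁻¹ • T (x n) ζ₀)).det) Filter.atTop
        (nhds (Gᴴ * G).det) := by
      have hcont : Continuous fun M : Matrix (Fin q) (Fin p) ℂ => (Gᴴ * M).det := by fun_prop
      exact (hcont.tendsto G).comp hTG
    obtain ⟨n, hn⟩ := (hdet.eventually_ne hdetG).exists
    refine ⟨n, fun h0 => hn ?_⟩
    rw [Matrix.mul_smul, Matrix.det_smul]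
    simp only [hE] at h0
    rw [h0, mul_zero]
  filter_upwards [ae_ne_zero_of_differentiableOn hU hUc hUr (hE1 ζ₀) (hx n) hn] with y hy
  apply ae_addCircle_of_ae_real
  have hpi : (2 * π * Complex.I : ℂ) ≠ 0 := Complex.two_pi_I_ne_zero
  have hae := ae_ne_zero_of_differentiableOn (U := Set.univ)
    (f := fun t => E y (-(2 * π * Complex.I) * t - (2 * γ * y * (b * p) : ℝ)))
    (z₀ := -(ζ₀ + (2 * γ * y * (b * p) : ℝ)) / (2 * π * Complex.I))
    isOpen_univ isPreconnected_univ (fun _ => Set.mem_univ _)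
    (((hE2 y (hUr y)).comp (by fun_prop)).differentiableOn) (Set.mem_univ _) (by
      convert hy using 2
      field_simp
      ring)
  filter_upwards [hae] with t ht v hv
  set ζ : ℂ := -(2 * π * Complex.I) * t - (2 * γ * y * (b * p) : ℝ) with hζ
  have hw : (Gᴴ * T y ζ) *ᵥ (fun s => v s * Complex.exp (-(2 * γ * y * (b * (s : ℕ)) : ℝ))) = 0 := by
    rw [← Matrix.mulVec_mulVec]
    refine (congrArg (Gᴴ *ᵥ ·) (funext fun r => ?_)).trans (Matrix.mulVec_zero Gᴴ)
    simp only [Matrix.mulVec, dotProduct, hT, Matrix.of_apply, Pi.zero_apply, gaussSeries]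
    have h1 := congrArg (Complex.exp (γ * y ^ 2 - 2 * γ * y * (r * α)) * ·) (hv r)
    simp only [mul_zero, Finset.mul_sum] at h1
    rw [← h1]
    refine Finset.sum_congr rfl fun s _ => ?_
    rw [mul_left_comm, mul_left_comm (Complex.exp (γ * y ^ 2 - _)) (v s)]
    congr 1
    rw [← tsum_mul_right, ← tsum_mul_left]
    refine tsum_congr fun m => ?_
    rw [fourier_coe_apply, mul_assoc, mul_assoc, mul_left_comm (Complex.exp (γ * y ^ 2 - _)),
      ← Complex.exp_add, ← Complex.exp_add, mul_assoc (R _), ← Complex.exp_add]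
    congr 2
    · push_cast; ring_nf
    · rw [hζ]; push_cast; ring
  have h3 := Matrix.eq_zero_of_mulVec_eq_zero ht hw
  ext s
  simpa using congrFun h3 s

end GenericRank

section Periodization

theorem ae_eq_zero_of_integral_continuousMap_mul {X : Type*} [TopologicalSpace X] [CompactSpace X]
    [HasOuterApproxClosed X] [MeasurableSpace X] [BorelSpace X]
    {μ : Measure X} [IsFiniteMeasure μ] {f : X → ℂ} (hf : Integrable f μ)
    (h : ∀ φ : C(X, ℂ), ∫ x, φ x * f x ∂μ = 0) : f =ᵐ[μ] 0 := by
  refine ae_eq_zero_of_forall_setIntegral_isClosed_eq_zero hf fun F hF => ?_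
  rw [← integral_indicator hF.measurableSet]
  have hlim : Filter.Tendsto (fun n : ℕ => ∫ x, ((hF.apprSeq n x : ℝ) : ℂ) * f x ∂μ) Filter.atTop
      (nhds (∫ x, F.indicator f x ∂μ)) := by
    refine tendsto_integral_of_dominated_convergence (fun x => ‖f x‖) (fun n => ?_) hf.norm
      (fun n => Filter.Eventually.of_forall fun x => ?_)
      (Filter.Eventually.of_forall fun x => ?_)
    · refine Continuous.aestronglyMeasurable ?_ |>.mul hf.1
      have := (hF.apprSeq n).continuous
      fun_prop
    · rw [norm_mul]
      refine mul_le_of_le_one_left (norm_nonneg _) ?_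
      have := HasOuterApproxClosed.apprSeq_apply_le_one hF n x
      simpa using this
    · have h1 := tendsto_pi_nhds.1 (HasOuterApproxClosed.tendsto_apprSeq hF) x
      have h2 : Continuous fun t : NNReal => ((t : ℝ) : ℂ) * f x := by fun_prop
      have h3 := (h2.tendsto _).comp h1
      refine h3.congr' (Filter.Eventually.of_forall fun n => rfl) |>.trans (le_of_eq ?_)
      by_cases hx : x ∈ F <;> simp [hx]
  refine tendsto_nhds_unique hlim (tendsto_const_nhds.congr fun n => ?_)
  have hc : Continuous fun x => ((hF.apprSeq n x : ℝ) : ℂ) := by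
    have := (hF.apprSeq n).continuous
    fun_prop
  exact (h ⟨_, hc⟩).symm

theorem ae_eq_zero_of_integral_fourier_mul {T : ℝ} [Fact (0 < T)] {f : AddCircle T → ℂ}
    {μ : Measure (AddCircle T)} [IsFiniteMeasure μ]
    (hf : Integrable f μ) (h : ∀ n : ℤ, ∫ x, fourier n x * f x ∂μ = 0) : f =ᵐ[μ] 0 := by
  have hφf : ∀ φ : C(AddCircle T, ℂ), Integrable (fun x => φ x * f x) μ := fun φ =>
    hf.bdd_mul φ.continuous.aestronglyMeasurable
      (Filter.Eventually.of_forall fun x => φ.norm_coe_le_norm x)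
  let L : C(AddCircle T, ℂ) →ₗ[ℂ] ℂ :=
    { toFun := fun φ => ∫ x, φ x * f x ∂μ
      map_add' := fun φ ψ => by
        rw [← integral_add (hφf φ) (hφf ψ)]
        simp only [ContinuousMap.add_apply, add_mul]
      map_smul' := fun c φ => by
        simp only [ContinuousMap.smul_apply, smul_eq_mul, mul_assoc, RingHom.id_apply]
        rw [integral_const_mul] }
  let L' := L.mkContinuous (∫ x, ‖f x‖ ∂μ) fun φ => by
    refine (norm_integral_le_integral_norm _).trans ?_
    rw [mul_comm, ← integral_const_mul]
    refine integral_mono (hφf φ).norm (hf.norm.const_mul _) fun x => ?_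
    simp only [norm_mul]
    exact mul_le_mul_of_nonneg_right (φ.norm_coe_le_norm x) (norm_nonneg _)
  refine ae_eq_zero_of_integral_continuousMap_mul hf fun φ => ?_
  have hker : (⊤ : Submodule ℂ C(AddCircle T, ℂ)) ≤ L'.ker := by
    rw [← span_fourier_closure_eq_top]
    refine Submodule.topologicalClosure_minimal _ (Submodule.span_le.2 ?_) L'.isClosed_ker
    rintro _ ⟨n, rfl⟩
    exact h n
  exact hker (Submodule.mem_top (x := φ))

theorem ae_real_of_ae_Ioc {P : ℝ → Prop} (hP : ∀ (x : ℝ) (n : ℤ), P (x + n) → P x)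
    (h : ∀ᵐ x ∂(volume.restrict (Set.Ioc (0 : ℝ) 1)), P x) : ∀ᵐ x : ℝ, P x := by
  rw [ae_restrict_iff' measurableSet_Ioc] at h
  have h1 : ∀ᵐ x : ℝ, ∀ n : ℤ, x + n ∈ Set.Ioc (0 : ℝ) 1 → P (x + n) := by
    rw [ae_all_iff]
    intro n
    exact (measurePreserving_add_right volume (n : ℝ)).quasiMeasurePreserving.ae h
  filter_upwards [h1] with x hx
  obtain ⟨n, hn, -⟩ := existsUnique_add_zsmul_mem_Ioc (one_pos : (0 : ℝ) < 1) x 0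
  have hn' : x + n ∈ Set.Ioc (0 : ℝ) 1 := by simpa using hn
  exact hP x n (hx n hn')

theorem ae_periodization_int {h : ℝ → ℂ} (hh : Integrable h) :
    (∀ᵐ x : ℝ, Summable fun j : ℤ => ‖h (x + j)‖) ∧
    ((∀ n : ℤ, ∫ x : ℝ, Complex.exp (2 * π * I * n * x) * h x = 0) →
      ∀ᵐ x : ℝ, ∑' j : ℤ, h (x + j) = 0) := by
  have hhj : ∀ j : ℤ, Integrable fun x => h (x + j) := fun j => hh.comp_add_right (j : ℝ)
  have hm : ∀ j : ℤ, MemLp (fun x => h (x + j)) 1 (volume.restrict (Set.Ioc (0 : ℝ) (0 + 1))) :=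
    fun j => (memLp_one_iff_integrable.2 (hhj j)).restrict _
  set F : ℤ → UnitAddCircle → ℂ := fun j => AddCircle.liftIoc 1 0 (fun x => h (x + j)) with hF
  have hFm : ∀ j, MemLp (F j) 1 := fun j => (hm j).memLp_liftIoc
  have hFapp : ∀ j, ∀ x ∈ Set.Ioc (0 : ℝ) 1, F j (x : UnitAddCircle) = h (x + j) := fun j x hx => by
    rw [hF]
    exact AddCircle.liftIoc_coe_apply (by simpa using hx)
  have hnorm : ∑' j, eLpNorm (F j) 1 ≠ ⊤ := by
    have h1 : Summable fun j : ℤ => ∫ x in (0 : ℝ)..1, ‖h (x + j)‖ :=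
      hh.norm.hasSum_intervalIntegral_comp_add_int.summable
    have h2 : ∀ j, eLpNorm (F j) 1 = ENNReal.ofReal (∫ x in (0 : ℝ)..1, ‖h (x + j)‖) := by
      intro j
      rw [eLpNorm_one_eq_lintegral_enorm,
        ← ofReal_integral_norm_eq_lintegral_enorm (memLp_one_iff_integrable.1 (hFm j))]
      congr 1
      rw [← AddCircle.integral_preimage 1 0, intervalIntegral.integral_of_le zero_le_one, zero_add]
      exact setIntegral_congr_fun measurableSet_Ioc fun x hx => by simp only [hFapp j x hx]
    simp only [h2]
    exact h1.tsum_ofReal_ne_top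
  have hsum := summable_norm_of_tsum_eLpNorm_ne_top le_rfl (fun j => (hFm j).1) hnorm
  have hback : ∀ {Q : UnitAddCircle → Prop}, (∀ᵐ ω, Q ω) →
      ∀ᵐ x : ℝ ∂(volume.restrict (Set.Ioc (0 : ℝ) 1)), Q (x : UnitAddCircle) := fun {Q} hQ => by
    have := (UnitAddCircle.measurePreserving_mk 0).quasiMeasurePreserving.ae hQ
    simpa using this
  constructor
  · refine ae_real_of_ae_Ioc (fun x n hx => ?_) ?_
    · refine ((Equiv.addRight n).summable_iff.1 ?_ : Summable fun j : ℤ => ‖h (x + j)‖)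
      refine hx.congr fun j => ?_
      simp [add_assoc, add_comm]
    · filter_upwards [hback hsum, ae_restrict_mem measurableSet_Ioc] with x hx hx'
      exact hx.congr fun j => by rw [hFapp j x hx']
  · intro hz
    have hS : ∀ᵐ ω : UnitAddCircle, HasSum (fun j => F j ω) ((∑' j, (hFm j).toLp (F j) : Lp ℂ 1) ω) := by
      have h1 := Lp.hasSum_coeFn_tsum (f := fun j => (hFm j).toLp (F j)) (by
        simpa only [Lp.enorm_toLp] using hnorm)
      have h2 : ∀ᵐ ω : UnitAddCircle, ∀ j, (hFm j).toLp (F j) ω = F j ω :=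
        ae_all_iff.2 fun j => (hFm j).coeFn_toLp
      filter_upwards [h1, h2] with ω h1 h2
      simpa only [h2] using h1
    set S : Lp ℂ 1 (volume : Measure UnitAddCircle) := ∑' j, (hFm j).toLp (F j)
    have hS0 : S =ᵐ[volume] 0 := by
      refine ae_eq_zero_of_integral_fourier_mul (L1.integrable_coeFn S) fun n => ?_
      have hi : ∀ j, Integrable (fun ω => fourier n ω * F j ω) := fun j =>
        (memLp_one_iff_integrable.1 (hFm j)).bdd_mul
          (fourier n).continuous.aestronglyMeasurable
          (Filter.Eventually.of_forall fun x => (fourier n).norm_coe_le_norm x)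
      have he : Integrable fun x : ℝ => Complex.exp (2 * π * I * n * x) * h x :=
        hh.bdd_mul (c := 1) (Continuous.aestronglyMeasurable (by fun_prop))
          (Filter.Eventually.of_forall fun x => le_of_eq (by
            rw [show (2 * π * I * n * x : ℂ) = ((2 * π * n * x : ℝ) : ℂ) * I by push_cast; ring]
            exact Complex.norm_exp_ofReal_mul_I _))
      have h1 : ∀ j, ∫ ω, fourier n ω * F j ω =
          ∫ x in (0 : ℝ)..1, Complex.exp (2 * π * I * n * (x + j : ℝ)) * h (x + j) := fun j => by
        rw [← AddCircle.integral_preimage 1 0, intervalIntegral.integral_of_le zero_le_one,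
          zero_add]
        refine setIntegral_congr_fun measurableSet_Ioc fun x hx => ?_
        simp only [hFapp j x hx, fourier_coe_apply]
        congr 1
        rw [Complex.exp_eq_exp_iff_exists_int]
        refine ⟨-(n * j), ?_⟩
        push_cast
        ring
      have h2 := he.hasSum_intervalIntegral_comp_add_int
      rw [hz n] at h2
      have h3 : ∫ ω, fourier n ω * S ω = ∫ ω, ∑' j, fourier n ω * F j ω := by
        refine integral_congr_ae ?_
        filter_upwards [hS] with ω hω
        rw [tsum_mul_left, hω.tsum_eq]
      rw [h3, integral_tsum (fun j => (hi j).1)]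
      · simp only [h1]
        exact h2.tsum_eq
      · refine ne_top_of_le_ne_top hnorm (ENNReal.tsum_le_tsum fun j => ?_)
        rw [eLpNorm_one_eq_lintegral_enorm]
        refine lintegral_mono fun ω => le_of_eq ?_
        rw [enorm_mul, ← ofReal_norm (fourier n ω), fourier_apply, Circle.norm_coe,
          ENNReal.ofReal_one, one_mul]
    refine ae_real_of_ae_Ioc (fun x n hx => ?_) ?_
    · rw [← hx, ← (Equiv.addRight n).tsum_eq]
      refine tsum_congr fun j => ?_
      simp [add_assoc, add_comm]
    · filter_upwards [hback hS, hback hS0, ae_restrict_mem measurableSet_Ioc] with x hx hx0 hx'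
      rw [hx0] at hx
      simpa only [hFapp _ x hx', Pi.zero_apply] using hx.tsum_eq

theorem ae_periodization {b : ℝ} (hb : 0 < b) {h : ℝ → ℂ} (hh : Integrable h) :
    (∀ᵐ x : ℝ, Summable fun j : ℤ => ‖h (x + b * j)‖) ∧
    ((∀ n : ℤ, ∫ x : ℝ, Complex.exp (2 * π * I * (b⁻¹ * n * x)) * h x = 0) →
      ∀ᵐ x : ℝ, ∑' j : ℤ, h (x + b * j) = 0) := by
  have hb' : b ≠ 0 := hb.ne'
  obtain ⟨h1, h2⟩ := ae_periodization_int (hh.comp_mul_left' hb')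
  have hq : ∀ {P : ℝ → Prop}, (∀ᵐ x, P (b * x)) → ∀ᵐ x, P x := fun {P} hP => by
    rw [ae_iff] at hP ⊢
    have h0 := Real.volume_preimage_mul_left (inv_ne_zero hb') {x | ¬ P (b * x)}
    rw [hP, mul_zero] at h0
    simpa [hb'] using h0
  constructor
  · refine hq ?_
    filter_upwards [h1] with x hx
    simpa only [mul_add] using hx
  · intro hz
    refine hq ?_
    have h3 := h2 fun n => ?_
    · filter_upwards [h3] with x hx
      simpa only [mul_add] using hx
    · have := Measure.integral_comp_mul_left
        (fun x : ℝ => Complex.exp (2 * π * I * (b⁻¹ * n * x)) * h x) b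
      rw [hz n, smul_zero] at this
      rw [← this]
      congr with x
      congr 2
      have : (b : ℂ) ≠ 0 := by exact_mod_cast hb'
      push_cast
      field_simp

end Periodization

section Fiberization

open AddCircle in
theorem eq_zero_of_tsum_shift_eq_zero {ι κ : Type*} [Fintype ι] [Finite κ] {F : ι → ℤ → ℂ}
    (hF : ∀ s, Summable fun m => ‖F s m‖ ^ 2) {G : κ → ι → ℤ → ℂ}
    (hG : ∀ r s, Summable fun m => ‖G r s m‖)
    (horth : ∀ r (k : ℤ), ∑ s, ∑' m, F s m * G r s (m - k) = 0)
    (hinj : ∀ᵐ ω : AddCircle (1 : ℝ), ∀ v : ι → ℂ,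
      (∀ r, ∑ s, v s * ∑' m : ℤ, G r s m * fourier (-m) ω = 0) → v = 0) : F = 0 := by
  have hvol : (volume : Measure (AddCircle (1 : ℝ))) = haarAddCircle := by
    rw [volume_eq_smul_haarAddCircle]; simp
  rw [hvol] at hinj
  let a : ι → lp (fun _ : ℤ => ℂ) 2 := fun s => ⟨F s, memℓp_gen (by simpa using hF s)⟩
  let φ : ι → Lp ℂ 2 (haarAddCircle (T := (1 : ℝ))) := fun s => fourierBasis.repr.symm (a s)
  have hφ : ∀ s m, fourierCoeff (φ s) m = F s m := fun s m => by
    rw [← fourierBasis_repr]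
    simp [φ, a]
  have hφi : ∀ s, Integrable (φ s) haarAddCircle := fun s =>
    (Lp.memLp (φ s)).integrable (by norm_num)
  have hnf : ∀ (n : ℤ) (ω : AddCircle (1 : ℝ)), ‖fourier n ω‖ = 1 := fun n ω => by
    rw [fourier_apply, Circle.norm_coe]
  have hfi : ∀ (n : ℤ) s, Integrable (fun ω => fourier n ω * φ s ω) haarAddCircle := fun n s =>
    (hφi s).bdd_mul (c := 1) (fourier n).continuous.aestronglyMeasurable
      (Filter.Eventually.of_forall fun ω => (hnf n ω).le)
  have hcoef : ∀ r s (k : ℤ), ∫ ω, fourier (-k) ω * (φ s ω * ∑' m, G r s m * fourier (-m) ω)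
      ∂haarAddCircle = ∑' m, F s m * G r s (m - k) := fun r s k => by
    have h1 := hasSum_integral_of_summable_integral_norm (μ := haarAddCircle)
      (F := fun (m : ℤ) ω => G r s m * (fourier (-(m + k)) ω * φ s ω))
      (fun m => (hfi _ s).const_mul _) (by
        simp only [norm_mul, hnf, one_mul, integral_const_mul]
        exact (hG r s).mul_right _)
    have h2 : ∀ m : ℤ, ∫ ω, G r s m * (fourier (-(m + k)) ω * φ s ω) ∂haarAddCircle =
        F s (m + k) * G r s m := fun m => by
      rw [integral_const_mul, ← hφ s (m + k), fourierCoeff, mul_comm]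
      simp only [smul_eq_mul]
    simp only [h2] at h1
    rw [← (Equiv.addRight k).tsum_eq]
    simp only [Equiv.coe_addRight, add_sub_cancel_right]
    rw [h1.tsum_eq]
    congr with ω
    rw [← mul_assoc, ← tsum_mul_left]
    refine tsum_congr fun m => ?_
    rw [neg_add, fourier_add]
    ring
  have hgb : ∀ r s ω, ‖∑' m, G r s m * fourier (-m) ω‖ ≤ ∑' m, ‖G r s m‖ := fun r s ω =>
    tsum_of_norm_bounded (hG r s).hasSum fun m => by rw [norm_mul, hnf, mul_one]
  have hgc : ∀ r s, Continuous fun ω : AddCircle (1 : ℝ) => ∑' m, G r s m * fourier (-m) ω :=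
    fun r s => continuous_tsum (fun m => by fun_prop) (hG r s) fun m ω => by
      rw [norm_mul, hnf, mul_one]
  have hpi : ∀ r s, Integrable (fun ω => φ s ω * ∑' m, G r s m * fourier (-m) ω) haarAddCircle :=
    fun r s => (hφi s).mul_bdd (hgc r s).aestronglyMeasurable
      (Filter.Eventually.of_forall fun ω => hgb r s ω)
  have hzero : ∀ᵐ ω ∂(haarAddCircle (T := (1 : ℝ))), ∀ r,
      ∑ s, φ s ω * ∑' m, G r s m * fourier (-m) ω = 0 := by
    rw [ae_all_iff]
    intro r
    refine ae_eq_zero_of_integral_fourier_mul (integrable_finsetSum _ fun s _ => hpi r s)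
      fun n => ?_
    simp only [Finset.mul_sum]
    rw [integral_finsetSum _ fun s _ => (hpi r s).bdd_mul (c := 1)
      (fourier n).continuous.aestronglyMeasurable
      (Filter.Eventually.of_forall fun ω => (hnf n ω).le), ← horth r (-n)]
    refine Finset.sum_congr rfl fun s _ => ?_
    rw [← hcoef, neg_neg]
  have hφ0 : ∀ s, φ s =ᵐ[haarAddCircle] 0 := fun s => by
    filter_upwards [hinj, hzero] with ω h1 h2
    exact congrFun (h1 (fun s => φ s ω) h2) s
  ext s m
  rw [← hφ, fourierCoeff_congr_ae (hφ0 s)]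
  simp [fourierCoeff]

end Fiberization

section Completeness

theorem gaborComplete_of_forall_orthogonal {g : ℝ → ℂ} (hg : MemLp g 2) {α β : ℝ}
    (h : ∀ f : ℝ → ℂ, MemLp f 2 → (∀ k l : ℤ, ∫ x : ℝ,
      Complex.exp (2 * π * I * (β * l * x)) * (f x * g (x - α * k)) = 0) → f =ᵐ[volume] 0) :
    GaborComplete g α β := by
  rw [GaborComplete, Submodule.topologicalClosure_eq_top_iff, Submodule.eq_bot_iff]
  intro f hf
  have hf0 := h (fun x => starRingEnd ℂ (f x)) (Lp.memLp f).star fun k l => by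
    have hg1 : MemLp (fun x => g (x - α * k)) 2 :=
      hg.comp_measurePreserving (measurePreserving_sub_right volume (α * k))
    have hg2 : MemLp (fun x : ℝ =>
        Complex.exp (2 * π * I * (β * l * x)) * g (x - α * k)) 2 := by
      refine hg1.of_le (AEStronglyMeasurable.mul
        (Continuous.aestronglyMeasurable (by fun_prop)) hg1.1)
        (Filter.Eventually.of_forall fun x => le_of_eq ?_)
      rw [norm_mul, show (2 * π * I * (β * l * x) : ℂ) = ((2 * π * (β * l * x) : ℝ) : ℂ) * I by
        push_cast; ring, Complex.norm_exp_ofReal_mul_I, one_mul]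
    have h0 := (Submodule.mem_orthogonal' _ _).1 hf (hg2.toLp _)
      (Submodule.subset_span ⟨k, l, hg2.coeFn_toLp⟩)
    rw [L2.inner_def] at h0
    rw [← h0]
    refine integral_congr_ae ?_
    filter_upwards [hg2.coeFn_toLp] with x hx
    rw [hx, RCLike.inner_apply]
    ring
  refine Lp.eq_zero_iff_ae_eq_zero.2 ?_
  filter_upwards [hf0] with x hx
  simpa using hx

theorem gaborComplete_of_ae_injective {g : ℝ → ℂ} (hg : MemLp g 2) {α β : ℝ} (hβ : 0 < β)
    {p q : ℕ} [NeZero p] [NeZero q] (hpq : α * q = β⁻¹ * p)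
    (hsum : ∀ᵐ y : ℝ, ∀ (r : Fin q) (s : Fin p),
      Summable fun m : ℤ => ‖g (y + (β⁻¹ * (p * m + (s : ℕ)) - r * α))‖)
    (hinj : ∀ᵐ y : ℝ, ∀ᵐ ω : AddCircle (1 : ℝ), ∀ v : Fin p → ℂ,
      (∀ r : Fin q, ∑ s : Fin p, v s * ∑' m : ℤ,
        g (y + (β⁻¹ * (p * m + (s : ℕ)) - r * α)) * fourier (-m) ω = 0) → v = 0) :
    GaborComplete g α β := by
  refine gaborComplete_of_forall_orthogonal hg fun f hf horth => ?_
  have hb : 0 < β⁻¹ := inv_pos.2 hβ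
  have hi : ∀ k : ℤ, Integrable fun x => f x * g (x - α * k) := fun k =>
    hf.integrable_mul (hg.comp_measurePreserving (measurePreserving_sub_right volume (α * k)))
  have h1 : ∀ᵐ x : ℝ, ∀ k : ℤ,
      Summable fun j : ℤ => ‖f (x + β⁻¹ * j) * g (x + β⁻¹ * j - α * k)‖ :=
    ae_all_iff.2 fun k => (ae_periodization hb (hi k)).1
  have h2 : ∀ᵐ x : ℝ, ∀ k : ℤ,
      ∑' j : ℤ, f (x + β⁻¹ * j) * g (x + β⁻¹ * j - α * k) = 0 :=
    ae_all_iff.2 fun k => (ae_periodization hb (hi k)).2 fun n => by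
      simpa using horth k n
  have hf2 : Integrable fun x => ((‖f x‖ ^ 2 : ℝ) : ℂ) :=
    ((memLp_two_iff_integrable_sq_norm hf.1).1 hf).ofReal
  filter_upwards [h1, h2, (ae_periodization hb hf2).1, hsum, hinj] with x h1 h2 h3 h4 h5
  have hres : ∀ s : Fin p, Function.Injective fun m : ℤ => (p : ℤ) * m + (s : ℕ) :=
    fun s m n h => by simpa [NeZero.ne p] using h
  have hF := eq_zero_of_tsum_shift_eq_zero
    (F := fun (s : Fin p) (m : ℤ) => f (x + β⁻¹ * (p * m + (s : ℕ))))
    (G := fun (r : Fin q) s m => g (x + (β⁻¹ * (p * m + (s : ℕ)) - r * α)))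
    (fun s => by
      have := h3.comp_injective (hres s)
      simpa [Function.comp_def] using this) h4 (fun r k => ?_) h5
  · have := congrFun (congrFun hF 0) 0
    simpa using this
  · set f' : ℤ → ℂ := fun j =>
      f (x + β⁻¹ * j) * g (x + β⁻¹ * j - α * ((q * k + (r : ℕ) : ℤ) : ℝ)) with hf'
    have h6 : ∀ s : Fin p, HasSum (fun m : ℤ => f' (p * m + (s : ℕ)))
        (∑' m : ℤ, f (x + β⁻¹ * (p * m + (s : ℕ))) *
          g (x + (β⁻¹ * (p * ((m - k : ℤ) : ℝ) + (s : ℕ)) - r * α))) := fun s => by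
      have h7 : Summable fun m : ℤ => f' (p * m + (s : ℕ)) :=
        (h1 (q * k + (r : ℕ))).of_norm.comp_injective (hres s)
      convert h7.hasSum using 1
      refine tsum_congr fun m => ?_
      simp only [hf']
      push_cast
      congr 2
      linear_combination (k : ℝ) * hpq
    exact (hasSum_int_of_residues h6).tsum_eq.symm.trans (h2 (q * k + (r : ℕ)))

end Completeness

section TameCompleteness

variable {U : Set ℂ} {x : ℕ → ℂ} {lam : ℂ} {R : ℂ → ℂ}

theorem IsTameAlong.norm_mul_gaussian_le (hR : IsTameAlong U x lam R) (hU0 : 0 ∈ U)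
    (hUadd : ∀ z ∈ U, ∀ a : ℝ, z + a ∈ U) (γ : ℝ) :
    ∃ C A : ℝ, 0 ≤ C ∧ ∀ a : ℝ, ‖R a * Complex.exp (-γ * a ^ 2)‖ ≤
      C * Real.exp (A * |a| - γ * a ^ 2) := by
  obtain ⟨C, A, hC, -, h⟩ := hR.norm_term_le hUadd
  refine ⟨C, A, hC, fun a => ?_⟩
  simpa using h γ 0 0 0 0 hU0 (by simp) 0 (by simp) a

theorem memLp_two_of_norm_le_gaussian {g : ℝ → ℂ} (hg : Continuous g) {γ C A : ℝ} (hγ : 0 < γ)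
    (hC : 0 ≤ C) (h : ∀ a, ‖g a‖ ≤ C * Real.exp (A * |a| - γ * a ^ 2)) : MemLp g 2 := by
  have hgauss : MemLp (fun a : ℝ => C * Real.exp (A ^ 2 / (2 * γ)) *
      Real.exp (-(γ / 2) * a ^ 2)) 2 := by
    refine MemLp.const_mul ?_ _
    rw [memLp_two_iff_integrable_sq (Continuous.aestronglyMeasurable (by fun_prop))]
    refine (integrable_exp_neg_mul_sq hγ).congr (Filter.Eventually.of_forall fun a => ?_)
    simp only [← Real.exp_nat_mul]
    congr 1
    push_cast
    ring
  refine hgauss.of_le hg.aestronglyMeasurable (Filter.Eventually.of_forall fun a => ?_)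
  refine (h a).trans ?_
  rw [Real.norm_of_nonneg (by positivity), mul_assoc, ← Real.exp_add]
  refine mul_le_mul_of_nonneg_left (Real.exp_le_exp.2 ?_) hC
  have h1 : 0 ≤ (A - γ * |a|) ^ 2 / (2 * γ) := by positivity
  have h2 : (A - γ * |a|) ^ 2 / (2 * γ) = A ^ 2 / (2 * γ) - A * |a| + γ / 2 * a ^ 2 := by
    rw [sub_sq, mul_pow, sq_abs]
    field_simp
  linarith

theorem IsTameAlong.gaborComplete (hR : IsTameAlong U x lam R) (hU : IsOpen U)
    (hUc : IsPreconnected U) (hU0 : 0 ∈ U) (hUadd : ∀ z ∈ U, ∀ a : ℝ, z + a ∈ U)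
    (hx : ∀ n, x n ∈ U) {γ α β : ℝ} (hγ : 0 < γ) (hα : 0 < α) (hβ : 0 < β)
    (hrat : ∃ r : ℚ, α * β = (r : ℝ)) (hle : α * β ≤ 1) :
    GaborComplete (fun a : ℝ => R a * Complex.exp (-γ * a ^ 2)) α β := by
  obtain ⟨r, hr⟩ := hrat
  have hr0 : 0 < r := by
    have : (0 : ℝ) < r := hr ▸ mul_pos hα hβ
    exact_mod_cast this
  have hnum : 0 < r.num := Rat.num_pos.2 hr0
  set p : ℕ := r.num.natAbs with hp
  have hp0 : 0 < p := Int.natAbs_pos.2 hnum.ne'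
  have : NeZero p := ⟨hp0.ne'⟩
  have : NeZero r.den := ⟨r.den_nz⟩
  have hden : (0 : ℝ) < r.den := by exact_mod_cast r.den_pos
  have hrp : (r : ℝ) * r.den = p := by
    have h1 : ((p : ℤ) : ℚ) = r.num := by rw [hp, Int.natAbs_of_nonneg hnum.le]
    have h2 : r * r.den = p := by rw [Rat.mul_den_eq_num, ← h1]; simp
    exact_mod_cast h2
  have hpq : p ≤ r.den := by
    have : (p : ℝ) ≤ r.den := by
      rw [← hrp, ← hr]
      exact mul_le_of_le_one_left hden.le hle
    exact_mod_cast this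
  have hαb : α * r.den = β⁻¹ * p := by
    rw [← hrp, ← hr]
    field_simp
  have hb : 0 < β⁻¹ := inv_pos.2 hβ
  obtain ⟨C, A, hC, hbound⟩ := hR.norm_mul_gaussian_le hU0 hUadd γ
  have hcont : Continuous fun a : ℝ => R a * Complex.exp (-γ * a ^ 2) := by
    refine Continuous.mul (continuous_iff_continuousAt.2 fun a => ?_) (by fun_prop)
    have ha : (a : ℂ) ∈ U := by simpa using hUadd 0 hU0 a
    exact ContinuousAt.comp (f := fun a : ℝ => (a : ℂ))
      (hR.differentiableOn.continuousOn.continuousAt (hU.mem_nhds ha))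
      Complex.continuous_ofReal.continuousAt
  refine gaborComplete_of_ae_injective (memLp_two_of_norm_le_gaussian hcont hγ hC hbound) hβ hαb
    (Filter.Eventually.of_forall fun y r' s => ?_)
    (hR.ae_injective hU hUc hU0 hUadd hx hγ hb hα hp0 hpq r.reduced hαb)
  have hp1 : (0 : ℝ) < p := by exact_mod_cast hp0
  refine Summable.of_nonneg_of_le (fun _ => norm_nonneg _) (fun m => (hbound _).trans ?_)
    ((summable_exp_neg_sq_affine hγ (mul_pos hb hp1) A 0
      (y + (β⁻¹ * (s : ℕ) - r' * α))).mul_left C)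
  refine mul_le_mul_of_nonneg_left (Real.exp_le_exp.2 (le_of_eq ?_)) hC
  have : y + (β⁻¹ * (p * m + (s : ℕ)) - r' * α) =
      β⁻¹ * p * m + (y + (β⁻¹ * (s : ℕ) - r' * α)) := by ring
  rw [this]
  ring

end TameCompleteness

section Rational

theorem IsTameAlong.mul {U : Set ℂ} {x : ℕ → ℂ} {lam mu : ℂ} {R S : ℂ → ℂ}
    (hR : IsTameAlong U x lam R) (hS : IsTameAlong U x mu S) :
    IsTameAlong U x (lam + mu) (fun z => R z * S z) := by
  obtain ⟨N, hN, D, B, hD⟩ := hR.asymptotic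
  obtain ⟨N', hN', D', B', hD'⟩ := hS.asymptotic
  refine ⟨hR.differentiableOn.mul hS.differentiableOn, ?_, fun n => N n * N' n, fun a => ?_,
    D * D', B + B', ?_⟩
  · obtain ⟨C, A, h⟩ := hR.growth
    obtain ⟨C', A', h'⟩ := hS.growth
    refine ⟨C * C', A + A', fun z hz => ?_⟩
    rw [norm_mul, add_mul, Real.exp_add, mul_mul_mul_comm]
    exact mul_le_mul (h z hz) (h' z hz) (norm_nonneg _) ((norm_nonneg _).trans (h z hz))
  · simp only [mul_div_mul_comm, add_mul, Complex.exp_add]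
    exact (hN a).mul (hN' a)
  · filter_upwards [hD, hD'] with n h h' a
    rw [mul_div_mul_comm, norm_mul, add_mul, Real.exp_add, mul_mul_mul_comm]
    exact mul_le_mul (h a) (h' a) (norm_nonneg _) ((norm_nonneg _).trans (h a))

theorem isTameAlong_const {U : Set ℂ} {x : ℕ → ℂ} {c : ℂ} (hc : c ≠ 0) :
    IsTameAlong U x 0 (fun _ => c) := by
  refine ⟨differentiableOn_const c, ⟨‖c‖, 0, by simp⟩, fun _ => c, fun a => ?_, 1, 0, ?_⟩
  · simp [hc]
  · simp [hc]

theorem isTameAlong_sub {U : Set ℂ} (ρ : ℂ) :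
    IsTameAlong U (fun n => n) 0 (fun z => z - ρ) := by
  refine ⟨by fun_prop, ⟨1 + ‖ρ‖, 1, fun z _ => ?_⟩, fun n => n, fun a => ?_, 1 + ‖ρ‖, 1, ?_⟩
  · have h1 : ‖z‖ + 1 ≤ Real.exp (1 * ‖z‖) := by simpa using Real.add_one_le_exp ‖z‖
    have h2 := norm_sub_le z ρ
    nlinarith [norm_nonneg z, norm_nonneg ρ]
  · have h1 : Filter.Tendsto (fun n : ℕ => 1 + ((a : ℂ) - ρ) / n) Filter.atTop (nhds 1) := by
      simpa using (tendsto_const_div_atTop_nhds_zero_nat ((a : ℂ) - ρ)).const_add 1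
    simp only [zero_mul, Complex.exp_zero]
    refine h1.congr' ?_
    filter_upwards [Filter.eventually_gt_atTop 0] with n hn
    have : (n : ℂ) ≠ 0 := by exact_mod_cast hn.ne'
    field_simp
    ring
  · filter_upwards [Filter.eventually_gt_atTop 0] with n hn a
    have hn1 : (1 : ℝ) ≤ n := by exact_mod_cast hn
    rw [norm_div, Complex.norm_natCast, div_le_iff₀ (by linarith)]
    have h1 : |a| + 1 ≤ Real.exp (1 * |a|) := by simpa using Real.add_one_le_exp |a|
    have h2 : ‖(n : ℂ) + a - ρ‖ ≤ n + |a| + ‖ρ‖ := by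
      refine (norm_sub_le _ _).trans (add_le_add_left ((norm_add_le _ _).trans ?_) _)
      simp
    have h3 : (n : ℝ) + |a| + ‖ρ‖ ≤ (1 + ‖ρ‖) * (|a| + 1) * n := by
      nlinarith [abs_nonneg a, norm_nonneg ρ, mul_nonneg (abs_nonneg a) (norm_nonneg ρ),
        mul_nonneg (abs_nonneg a) (sub_nonneg.2 hn1), mul_nonneg (norm_nonneg ρ) (sub_nonneg.2 hn1),
        mul_nonneg (mul_nonneg (abs_nonneg a) (norm_nonneg ρ)) (sub_nonneg.2 hn1)]
    refine h2.trans (h3.trans ?_)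
    gcongr

theorem isTameAlong_inv_sub {δ : ℝ} (hδ : 0 < δ) {σ : ℂ} (hσ : 2 * δ ≤ |σ.im|) :
    IsTameAlong {z | |z.im| < δ} (fun n => n) 0 (fun z => (z - σ)⁻¹) := by
  have hd : ∀ z : ℂ, |z.im| < δ → δ ≤ ‖z - σ‖ := fun z hz => by
    refine le_trans ?_ (Complex.abs_im_le_norm _)
    rw [Complex.sub_im]
    have := abs_sub_abs_le_abs_sub σ.im z.im
    rw [abs_sub_comm] at this
    linarith
  have hne : ∀ z : ℂ, |z.im| < δ → z - σ ≠ 0 := fun z hz => norm_pos_iff.1 (hδ.trans_le (hd z hz))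
  have hna : ∀ (n : ℕ) (a : ℝ), |((n : ℂ) + a).im| < δ := fun n a => by simpa using hδ
  have hform : ∀ (n : ℕ) (a : ℝ), ((n : ℂ) + a - σ)⁻¹ / (n : ℂ)⁻¹ =
      1 - (a - σ) * ((n : ℂ) + a - σ)⁻¹ := fun n a => by
    have := hne _ (hna n a)
    rw [div_inv_eq_mul]
    field_simp
    ring
  refine ⟨?_, ⟨δ⁻¹, 0, fun z hz => ?_⟩, fun n => (n : ℂ)⁻¹, fun a => ?_,
    1 + (1 + ‖σ‖) * δ⁻¹, 1, Filter.Eventually.of_forall fun n a => ?_⟩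
  · exact DifferentiableOn.inv (by fun_prop) fun z hz => hne z hz
  · simpa using inv_anti₀ hδ (hd z hz)
  · simp only [hform, zero_mul, Complex.exp_zero]
    have h1 : Filter.Tendsto (fun n : ℕ => (n : ℂ) + (a - σ)) Filter.atTop
        (Bornology.cobounded ℂ) := by
      rw [← tendsto_norm_atTop_iff_cobounded]
      refine Filter.tendsto_atTop_mono (f := fun n : ℕ => (n : ℝ) - ‖(a : ℂ) - σ‖) (fun n => ?_)
        (Filter.tendsto_atTop_add_const_right _ _ tendsto_natCast_atTop_atTop)
      have := norm_sub_le ((n : ℂ) + (a - σ)) (a - σ)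
      rw [add_sub_cancel_right, Complex.norm_natCast] at this
      linarith
    have h2 := ((Filter.tendsto_inv₀_cobounded.comp h1).const_mul ((a : ℂ) - σ)).const_sub 1
    simpa [Function.comp_def, add_sub_assoc] using h2
  · rw [hform]
    have h1 : |a| + 1 ≤ Real.exp (1 * |a|) := by simpa using Real.add_one_le_exp |a|
    have h2 : ‖((n : ℂ) + a - σ)⁻¹‖ ≤ δ⁻¹ := by
      rw [norm_inv]; exact inv_anti₀ hδ (hd _ (hna n a))
    have h3 : ‖(a : ℂ) - σ‖ ≤ |a| + ‖σ‖ := (norm_sub_le _ _).trans (by simp)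
    have h4 : ‖((a : ℂ) - σ) * ((n : ℂ) + a - σ)⁻¹‖ ≤ (|a| + ‖σ‖) * δ⁻¹ := by
      rw [norm_mul]; gcongr
    have h5 : 0 < δ⁻¹ := inv_pos.2 hδ
    refine (norm_sub_le _ _).trans ((add_le_add_right h4 _).trans ?_)
    rw [norm_one]
    have h6 : (|a| + ‖σ‖) * δ⁻¹ ≤ ((1 + ‖σ‖) * δ⁻¹) * (|a| + 1) := by
      have : 0 ≤ (1 + |a| * ‖σ‖) * δ⁻¹ := by positivity
      nlinarith
    have h7 : 0 ≤ (1 + ‖σ‖) * δ⁻¹ := by positivity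
    nlinarith [abs_nonneg a]

theorem isTameAlong_multiset_prod {U : Set ℂ} {x : ℕ → ℂ} {f : ℂ → ℂ → ℂ} (s : Multiset ℂ)
    (h : ∀ ρ ∈ s, IsTameAlong U x 0 (f ρ)) :
    IsTameAlong U x 0 (fun z => (s.map fun ρ => f ρ z).prod) := by
  induction s using Multiset.induction with
  | empty => simpa using isTameAlong_const one_ne_zero
  | cons ρ s ih =>
    have := (h ρ (by simp)).mul (ih fun ρ' h' => h ρ' (by simp [h']))
    simpa using this

theorem exists_strip_forall_roots (s : Multiset ℂ) (hs : ∀ σ ∈ s, σ.im ≠ 0) :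
    ∃ δ : ℝ, 0 < δ ∧ ∀ σ ∈ s, 2 * δ ≤ |σ.im| := by
  induction s using Multiset.induction with
  | empty => exact ⟨1, one_pos, by simp⟩
  | cons ρ s ih =>
    obtain ⟨δ, hδ, h⟩ := ih fun σ h' => hs σ (by simp [h'])
    have hρ := abs_pos.2 (hs ρ (by simp))
    refine ⟨min δ (|ρ.im| / 2), by positivity, fun σ hσ => ?_⟩
    rcases Multiset.mem_cons.1 hσ with rfl | hσ
    · linarith [min_le_right δ (|σ.im| / 2)]
    · linarith [min_le_left δ (|ρ.im| / 2), h σ hσ]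

theorem exists_isTameAlong_strip {P Q : Polynomial ℂ} (hP : P ≠ 0)
    (hQ : ∀ x : ℝ, Q.eval (x : ℂ) ≠ 0) :
    ∃ δ : ℝ, 0 < δ ∧
      IsTameAlong {z | |z.im| < δ} (fun n => n) 0 (fun z => P.eval z / Q.eval z) := by
  have hQ0 : Q ≠ 0 := fun h => hQ 0 (by simp [h])
  obtain ⟨δ, hδ, h⟩ := exists_strip_forall_roots Q.roots fun σ hσ h0 => hQ σ.re (by
    have : ((σ.re : ℝ) : ℂ) = σ := Complex.ext (by simp) (by simp [h0])
    rw [this]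
    exact (Polynomial.mem_roots'.1 hσ).2)
  refine ⟨δ, hδ, ?_⟩
  have h1 := ((isTameAlong_const (U := {z | |z.im| < δ}) (x := fun n => n)
      (Polynomial.leadingCoeff_ne_zero.2 hP)).mul
    (isTameAlong_multiset_prod P.roots fun ρ _ => isTameAlong_sub ρ)).mul
    ((isTameAlong_const (inv_ne_zero (Polynomial.leadingCoeff_ne_zero.2 hQ0))).mul
    (isTameAlong_multiset_prod Q.roots fun σ hσ => isTameAlong_inv_sub hδ (h σ hσ)))
  simp only [add_zero] at h1
  convert h1 using 2 with z
  rw [(IsAlgClosed.splits P).eval_eq_prod_roots, (IsAlgClosed.splits Q).eval_eq_prod_roots,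
    div_eq_mul_inv, mul_inv, Multiset.prod_map_inv]

end Rational

section ExponentialSums

theorem exists_isTameAlong_exp_sum {T : Finset ℂ} (hT : T.Nonempty) {c : ℂ → ℂ}
    (hc : ∀ μ ∈ T, c μ ≠ 0) : ∃ (x : ℕ → ℂ) (lam : ℂ),
      IsTameAlong Set.univ x lam (fun z => ∑ μ ∈ T, c μ * Complex.exp (μ * z)) := by
  obtain ⟨lam, hlam, hmax⟩ := T.exists_max_image (fun μ => toLex (μ.re, μ.im)) hT
  set x : ℕ → ℂ := fun n => (n : ℂ) ^ 2 - n * I with hx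
  have hre : ∀ (d : ℂ) (n : ℕ), (d * x n).re = d.re * n ^ 2 + d.im * n := fun d n => by
    simp [hx, pow_two]
  have hdecay : ∀ μ ∈ T, μ ≠ lam →
      Filter.Tendsto (fun n => ((μ - lam) * x n).re) Filter.atTop Filter.atBot := by
    intro μ hμ hne
    have hlex := hmax μ hμ
    rw [Prod.Lex.toLex_le_toLex] at hlex
    simp only [hre, Complex.sub_re, Complex.sub_im]
    have hn : Filter.Tendsto (fun n : ℕ => (n : ℝ)) Filter.atTop Filter.atTop :=
      tendsto_natCast_atTop_atTop
    rcases hlex with h | ⟨h, h'⟩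
    · have h1 : Filter.Tendsto (fun n : ℕ => (n : ℝ) * ((μ.re - lam.re) * n + (μ.im - lam.im)))
          Filter.atTop Filter.atBot :=
        hn.atTop_mul_atBot₀ (Filter.tendsto_atBot_add_const_right _ _
          (hn.const_mul_atTop_of_neg (sub_neg.2 h)))
      refine h1.congr fun n => ?_
      ring
    · have h2 : μ.im < lam.im := lt_of_le_of_ne h' fun h3 => hne (Complex.ext h h3)
      have h1 := hn.const_mul_atTop_of_neg (sub_neg.2 h2)
      refine h1.congr fun n => ?_
      simp only at h
      rw [h]
      ring
  have hform : ∀ (n : ℕ) (a : ℝ), (∑ μ ∈ T, c μ * Complex.exp (μ * (x n + a))) /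
      (c lam * Complex.exp (lam * x n)) =
        ∑ μ ∈ T, c μ / c lam * (Complex.exp ((μ - lam) * x n) * Complex.exp (μ * a)) :=
    fun n a => by
      rw [Finset.sum_div]
      refine Finset.sum_congr rfl fun μ _ => ?_
      rw [mul_div_mul_comm, ← Complex.exp_sub, ← Complex.exp_add]
      ring_nf
  have hexp : ∀ {z w : ℂ} {A : ℝ}, ‖z‖ ≤ A → ‖Complex.exp (z * w)‖ ≤ Real.exp (A * ‖w‖) :=
    fun {z w A} h => (Complex.norm_exp_le_exp_norm _).trans (Real.exp_le_exp.2 (by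
      rw [norm_mul]; gcongr))
  have hA : ∀ μ ∈ T, ‖μ‖ ≤ ∑ μ ∈ T, ‖μ‖ := fun μ hμ =>
    Finset.single_le_sum (f := fun μ => ‖μ‖) (fun _ _ => norm_nonneg _) hμ
  refine ⟨x, lam, by fun_prop, ⟨∑ μ ∈ T, ‖c μ‖, ∑ μ ∈ T, ‖μ‖, fun z _ => ?_⟩,
    fun n => c lam * Complex.exp (lam * x n), fun a => ?_,
    ∑ μ ∈ T, ‖c μ / c lam‖, ∑ μ ∈ T, ‖μ‖, ?_⟩
  · rw [Finset.sum_mul]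
    refine norm_sum_le_of_le _ fun μ hμ => ?_
    rw [norm_mul]
    exact mul_le_mul_of_nonneg_left (hexp (hA μ hμ)) (norm_nonneg _)
  · simp only [hform]
    have : Complex.exp (lam * a) = ∑ μ ∈ T, if μ = lam then Complex.exp (lam * a) else 0 := by
      rw [Finset.sum_ite_eq' T lam, if_pos hlam]
    rw [this]
    refine tendsto_finsetSum _ fun μ hμ => ?_
    by_cases h : μ = lam
    · subst h
      simp [hc μ hμ]
    · have h1 : Filter.Tendsto (fun n => Complex.exp ((μ - lam) * x n)) Filter.atTop (nhds 0) :=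
        Complex.tendsto_exp_nhds_zero_iff.2 (hdecay μ hμ h)
      simpa [h] using (h1.mul_const (Complex.exp (μ * a))).const_mul (c μ / c lam)
  · have h1 : ∀ᶠ n in Filter.atTop, ∀ μ ∈ T, ((μ - lam) * x n).re ≤ 0 := by
      rw [Filter.eventually_all_finset]
      intro μ hμ
      by_cases h : μ = lam
      · simp [h]
      · exact (hdecay μ hμ h).eventually_le_atBot 0
    filter_upwards [h1] with n hn a
    rw [hform, Finset.sum_mul]
    refine norm_sum_le_of_le _ fun μ hμ => ?_
    rw [norm_mul]
    refine mul_le_mul_of_nonneg_left ?_ (norm_nonneg _)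
    rw [norm_mul, Complex.norm_exp]
    have h2 := hexp (w := (a : ℂ)) (hA μ hμ)
    rw [Complex.norm_real, Real.norm_eq_abs] at h2
    exact (mul_le_of_le_one_left (norm_nonneg _) (Real.exp_le_one_iff.2 (hn μ hμ))).trans h2

theorem exists_finset_exp_sum {m : ℕ} (c lam : Fin m → ℂ) : ∃ (T : Finset ℂ) (d : ℂ → ℂ),
    (∀ μ ∈ T, d μ ≠ 0) ∧
      ∀ z, ∑ j, c j * Complex.exp (lam j * z) = ∑ μ ∈ T, d μ * Complex.exp (μ * z) := by
  classical
  set d : ℂ → ℂ := fun μ => ∑ j with lam j = μ, c j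
  refine ⟨(Finset.univ.image lam).filter (d · ≠ 0), d, fun μ hμ => (Finset.mem_filter.1 hμ).2,
    fun z => ?_⟩
  rw [Finset.sum_filter_of_ne (p := fun μ => d μ ≠ 0)
      (fun μ _ h h0 => h (by rw [h0, zero_mul])), ← Finset.sum_fiberwise_of_maps_to (g := lam) (t := Finset.univ.image lam) (by simp)]
  refine Finset.sum_congr rfl fun μ _ => ?_
  rw [Finset.sum_mul]
  exact Finset.sum_congr rfl fun j hj => by rw [(Finset.mem_filter.1 hj).2]

end ExponentialSums

theorem stmt_0 (γ : ℝ) (hγ : 0 < γ) (R : ℝ → ℂ)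
    (hRnz : ∃ x : ℝ, R x ≠ 0)
    (hR : (∃ P Q : Polynomial ℂ, (∀ x : ℝ, Q.eval (x : ℂ) ≠ 0) ∧
            ∀ x : ℝ, R x = P.eval (x : ℂ) / Q.eval (x : ℂ)) ∨
          (∃ (m : ℕ) (c lam : Fin m → ℂ),
            ∀ x : ℝ, R x = ∑ j : Fin m, c j * Complex.exp (lam j * x)))
    (g : ℝ → ℂ) (hg : ∀ x : ℝ, g x = R x * Complex.exp (-γ * x ^ 2))
    (α β : ℝ) (hα : 0 < α) (hβ : 0 < β)
    (hrat : ∃ r : ℚ, α * β = (r : ℝ)) (hle : α * β ≤ 1) :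
    GaborComplete g α β := by
  obtain rfl : g = fun x : ℝ => R x * Complex.exp (-γ * x ^ 2) := funext hg
  obtain ⟨x₀, hx₀⟩ := hRnz
  rcases hR with ⟨P, Q, hQ, hR⟩ | ⟨m, c, lam, hR⟩
  · obtain ⟨δ, hδ, h⟩ := exists_isTameAlong_strip (P := P) (by
      rintro rfl
      exact hx₀ (by simp [hR])) hQ
    have hU : {z : ℂ | |z.im| < δ} = Complex.imLm ⁻¹' Set.Ioo (-δ) δ := by
      ext z
      simp [abs_lt]
    simp only [hR]
    refine h.gaborComplete ?_ ?_ (by simpa using hδ) (fun z hz a => by simpa using hz)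
      (fun n => by simpa using hδ) hγ hα hβ hrat hle
    · exact isOpen_lt (by fun_prop) continuous_const
    · rw [hU]
      exact ((convex_Ioo _ _).linear_preimage _).isPreconnected
  · obtain ⟨T, d, hd, hT⟩ := exists_finset_exp_sum c lam
    have hT0 : T.Nonempty := by
      rw [Finset.nonempty_iff_ne_empty]
      rintro rfl
      exact hx₀ (by rw [hR, hT, Finset.sum_empty])
    obtain ⟨x, mu, h⟩ := exists_isTameAlong_exp_sum hT0 hd
    simp only [hR, hT]
    exact h.gaborComplete isOpen_univ isPreconnected_univ trivial (fun _ _ _ => trivial)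
      (fun _ => trivial) hγ hα hβ hrat hle
end

section
/- Let P be a non-zero complex polynomial and g(x) = P(x) e^{−πx²}. If α, β > 0 are such that αβ is rational and αβ ≤ 1, then the Gabor system G(g, α, β) is complete in L²(ℝ). -/
open MeasureTheory Complex Real

/-- Integration of continuous functions against a fixed integrable function. -/
noncomputable def integralAgainst {X : Type*} [TopologicalSpace X] [CompactSpace X]
    [MeasurableSpace X] [BorelSpace X] (μ : Measure X) (f : X → ℂ) (hf : Integrable f μ) :
    C(X, ℂ) →L[ℂ] ℂ :=
  have hi : ∀ ψ : C(X, ℂ), Integrable (fun x => ψ x * f x) μ := fun ψ =>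
    hf.bdd_mul ψ.continuous.aestronglyMeasurable (Filter.Eventually.of_forall ψ.norm_coe_le_norm)
  LinearMap.mkContinuous
    { toFun := fun ψ => ∫ x, ψ x * f x ∂μ
      map_add' := fun ψ φ => by
        simp only [ContinuousMap.add_apply, add_mul]
        exact integral_add (hi ψ) (hi φ)
      map_smul' := fun c ψ => by
        simp only [ContinuousMap.smul_apply, smul_eq_mul, mul_assoc, RingHom.id_apply]
        exact integral_const_mul _ _ }
    (∫ x, ‖f x‖ ∂μ) (fun ψ => by
      rw [← integral_mul_const]
      refine norm_integral_le_of_norm_le (hf.norm.mul_const _) (Filter.Eventually.of_forall ?_)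
      intro x
      rw [norm_mul, mul_comm]
      exact mul_le_mul_of_nonneg_left (ψ.norm_coe_le_norm x) (norm_nonneg _))

theorem integralAgainst_apply {X : Type*} [TopologicalSpace X] [CompactSpace X]
    [MeasurableSpace X] [BorelSpace X] (μ : Measure X) (f : X → ℂ) (hf : Integrable f μ)
    (ψ : C(X, ℂ)) : integralAgainst μ f hf ψ = ∫ x, ψ x * f x ∂μ := rfl

theorem ae_eq_zero_of_fourierCoeff_eq_zero {T : ℝ} [Fact (0 < T)] {f : AddCircle T → ℂ}
    (hf : Integrable f AddCircle.haarAddCircle) (h : ∀ n, fourierCoeff f n = 0) :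
    f =ᵐ[AddCircle.haarAddCircle] 0 := by
  have h1 : integralAgainst AddCircle.haarAddCircle f hf = 0 := by
    have hd : Dense (Submodule.span ℂ (Set.range (@fourier T)) : Set C(AddCircle T, ℂ)) := by
      rw [Submodule.dense_iff_topologicalClosure_eq_top]; exact span_fourier_closure_eq_top
    refine ContinuousLinearMap.ext_on hd ?_
    rintro _ ⟨n, rfl⟩
    have := h (-n)
    simpa [fourierCoeff, integralAgainst_apply] using this
  refine ae_eq_zero_of_forall_setIntegral_isClosed_eq_zero hf fun s hs => ?_
  have h2 : ∀ n, ∫ x, ((hs.apprSeq n x : ℝ) : ℂ) * f x ∂AddCircle.haarAddCircle = 0 := fun n =>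
    DFunLike.congr_fun h1 (⟨fun x => ((hs.apprSeq n x : ℝ) : ℂ), by fun_prop⟩ : C(AddCircle T, ℂ))
  have h3 : Filter.Tendsto
      (fun n => ∫ x, ((hs.apprSeq n x : ℝ) : ℂ) * f x ∂AddCircle.haarAddCircle) Filter.atTop
      (nhds (∫ x, s.indicator f x ∂AddCircle.haarAddCircle)) := by
    refine tendsto_integral_of_dominated_convergence (fun x => ‖f x‖) (fun n => ?_) hf.norm
      (fun n => ?_) ?_
    · exact AEStronglyMeasurable.mul (Continuous.aestronglyMeasurable (by fun_prop)) hf.1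
    · refine Filter.Eventually.of_forall fun x => ?_
      rw [norm_mul]
      refine mul_le_of_le_one_left (norm_nonneg _) ?_
      have := HasOuterApproxClosed.apprSeq_apply_le_one hs n x
      simpa using this
    · refine Filter.Eventually.of_forall fun x => ?_
      have := (tendsto_pi_nhds.1 (HasOuterApproxClosed.tendsto_apprSeq hs)) x
      have h4 : Filter.Tendsto (fun n => ((hs.apprSeq n x : ℝ) : ℂ) * f x) Filter.atTop
          (nhds ((((s.indicator (fun _ => (1 : NNReal)) x : NNReal) : ℝ) : ℂ) * f x)) :=
        (((Complex.continuous_ofReal.comp NNReal.continuous_coe).tendsto _).comp this).mul_const _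
      convert h4 using 2
      by_cases hx : x ∈ s <;> simp [hx]
  simp only [h2] at h3
  rw [← integral_indicator hs.measurableSet]
  exact (tendsto_nhds_unique tendsto_const_nhds h3).symm

/-- A summable trigonometric series is determined by its sum. -/
theorem eq_zero_of_hasSum_fourier {a : ℤ → ℂ} (ha : Summable fun n => ‖a n‖)
    (h : ∀ t : ℝ, ∑' n : ℤ, a n * Complex.exp (2 * π * I * n * t) = 0) : a = 0 := by
  have hs : Summable fun n : ℤ => a n • (fourier n : C(AddCircle (1 : ℝ), ℂ)) :=
    Summable.of_norm (by simpa only [norm_smul, fourier_norm, mul_one] using ha)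
  have h0 : ∑' n : ℤ, a n • (fourier n : C(AddCircle (1 : ℝ), ℂ)) = 0 := by
    ext x
    induction x using QuotientAddGroup.induction_on with
    | H t =>
      rw [← ContinuousMap.tsum_apply hs]
      simpa [fourier_coe_apply, mul_assoc] using h t
  ext m
  let μ := @AddCircle.haarAddCircle (1 : ℝ) _
  have hi : Integrable (fun x => (fourier (-m) : C(AddCircle (1 : ℝ), ℂ)) x) μ :=
    (fourier (-m) : C(AddCircle (1 : ℝ), ℂ)).continuous.integrable_of_hasCompactSupport
      (HasCompactSupport.of_compactSpace _)
  have h1 := (integralAgainst μ _ hi).hasSum hs.hasSum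
  rw [h0, map_zero] at h1
  have h2 : ∀ n, integralAgainst μ _ hi (a n • (fourier n : C(AddCircle (1 : ℝ), ℂ)))
      = a n * (Pi.single n (1 : ℂ) : ℤ → ℂ) m := by
    intro n
    rw [map_smul, smul_eq_mul, ← fourierCoeff_fourier (T := 1) n]
    simp [integralAgainst, fourierCoeff, mul_comm, μ]
  simp only [h2] at h1
  have h3 := hasSum_single (f := fun n => a n * (Pi.single n (1 : ℂ) : ℤ → ℂ) m) m
    (fun n hn => by simp [hn.symm])
  have := h3.unique h1
  simpa using this

theorem ae_summable_norm_of_summable_integral_norm {X ι : Type*} [MeasurableSpace X]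
    [Countable ι] {μ : Measure X} {F : ι → X → ℂ} (hF : ∀ i, Integrable (F i) μ)
    (hs : Summable fun i => ∫ x, ‖F i x‖ ∂μ) :
    (∫⁻ x, ∑' i, ‖F i x‖ₑ ∂μ < ⊤) ∧ ∀ᵐ x ∂μ, Summable fun i => ‖F i x‖ := by
  have h1 : ∫⁻ x, ∑' i, ‖F i x‖ₑ ∂μ < ⊤ := by
    rw [lintegral_tsum fun i => (hF i).1.enorm]
    have (i : ι) : ∫⁻ x, ‖F i x‖ₑ ∂μ = ENNReal.ofReal (∫ x, ‖F i x‖ ∂μ) :=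
      (ofReal_integral_norm_eq_lintegral_enorm (hF i)).symm
    simp only [this]
    exact hs.tsum_ofReal_lt_top
  refine ⟨h1, ?_⟩
  filter_upwards [ae_lt_top' (AEMeasurable.tsum fun i => (hF i).1.enorm) h1.ne] with x hx
  have h2 := ENNReal.summable_toReal hx.ne
  simpa using h2

theorem integrable_tsum_of_summable_integral_norm {X ι : Type*} [MeasurableSpace X]
    [Countable ι] {μ : Measure X} {F : ι → X → ℂ} (hF : ∀ i, Integrable (F i) μ)
    (hs : Summable fun i => ∫ x, ‖F i x‖ ∂μ) : Integrable (fun x => ∑' i, F i x) μ := by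
  obtain ⟨h1, h2⟩ := ae_summable_norm_of_summable_integral_norm hF hs
  refine ⟨?_, ?_⟩
  · refine aestronglyMeasurable_of_tendsto_ae (Filter.atTop : Filter (Finset ι))
      (f := fun s x => ∑ i ∈ s, F i x) (fun s => ?_) ?_
    · exact Finset.aestronglyMeasurable_fun_sum s fun i _ => (hF i).1
    · filter_upwards [h2] with x hx using hx.of_norm.hasSum
  · refine lt_of_le_of_lt (lintegral_mono_ae ?_) h1
    filter_upwards [h2] with x hx
    exact enorm_tsum_le_tsum_enorm

/-- An integrable function on the line whose Fourier transform vanishes on the integers has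
vanishing periodization. -/
theorem ae_tsum_comp_add_int_eq_zero {φ : ℝ → ℂ} (hφ : Integrable φ)
    (h : ∀ l : ℤ, ∫ x : ℝ, Complex.exp (2 * π * I * l * x) * φ x = 0) :
    ∀ᵐ t ∂(volume.restrict (Set.Ioc (0 : ℝ) 1)), ∑' n : ℤ, φ (t + n) = 0 := by
  have hcomp : ∀ n : ℤ, Integrable (fun t => φ (t + n)) (volume.restrict (Set.Ioc (0 : ℝ) 1)) :=
    fun n => (hφ.comp_add_right (n : ℝ)).integrableOn
  have hsum : Summable fun n : ℤ => ∫ t in Set.Ioc (0 : ℝ) 1, ‖φ (t + n)‖ := by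
    have := hφ.norm.hasSum_intervalIntegral_comp_add_int.summable
    simpa only [intervalIntegral.integral_of_le zero_le_one] using this
  have h_int := integrable_tsum_of_summable_integral_norm hcomp hsum
  have hexp : ∀ l n : ℤ, ∀ t : ℝ, Complex.exp (2 * π * I * l * ((t + n : ℝ) : ℂ))
      = Complex.exp (2 * π * I * l * t) := by
    intro l n t
    rw [Complex.exp_eq_exp_iff_exists_int]
    exact ⟨l * n, by push_cast; ring⟩
  have hnorm : ∀ l : ℤ, ∀ x : ℝ, ‖Complex.exp (2 * π * I * l * x)‖ = 1 := by
    intro l x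
    rw [show (2 * π * I * l * x : ℂ) = ((2 * π * l * x : ℝ) : ℂ) * I by push_cast; ring]
    exact Complex.norm_exp_ofReal_mul_I _
  have hzero : ∀ l : ℤ, ∫ t in Set.Ioc (0 : ℝ) 1,
      Complex.exp (2 * π * I * l * t) * ∑' n : ℤ, φ (t + n) = 0 := by
    intro l
    have hle : Integrable (fun x : ℝ => Complex.exp (2 * π * I * l * x) * φ x) :=
      hφ.bdd_mul (c := 1) (Continuous.aestronglyMeasurable (by fun_prop))
        (Filter.Eventually.of_forall fun x => (hnorm l x).le)
    have h1 := hle.hasSum_intervalIntegral_comp_add_int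
    rw [h l] at h1
    simp only [intervalIntegral.integral_of_le zero_le_one, hexp] at h1
    have h2 := hasSum_integral_of_summable_integral_norm (μ := volume.restrict (Set.Ioc (0 : ℝ) 1))
      (F := fun (n : ℤ) (t : ℝ) => Complex.exp (2 * π * I * l * t) * φ (t + n)) (fun n => ?_) ?_
    · simp only [tsum_mul_left] at h2
      exact h2.unique h1
    · exact (hcomp n).bdd_mul (c := 1) (Continuous.aestronglyMeasurable (by fun_prop))
        (Filter.Eventually.of_forall fun x => (hnorm l x).le)
    · simpa only [norm_mul, hnorm, one_mul] using hsum
  set Φ : ℝ → ℂ := fun t => ∑' n : ℤ, φ (t + n) with hΦ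
  have hlift : Integrable (AddCircle.liftIoc (1 : ℝ) 0 Φ) AddCircle.haarAddCircle := by
    have : MemLp (AddCircle.liftIoc (1 : ℝ) 0 Φ) 1 := by
      refine MemLp.memLp_liftIoc ?_
      rw [zero_add]
      exact memLp_one_iff_integrable.2 h_int
    rw [← memLp_haarAddCircle_iff] at this
    exact memLp_one_iff_integrable.1 this
  have hae := ae_eq_zero_of_fourierCoeff_eq_zero hlift (fun n => by
    rw [fourierCoeff_liftIoc_eq, fourierCoeffOn_eq_integral,
      intervalIntegral.integral_of_le (by norm_num)]
    have h0 := hzero (-n)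
    simp only [zero_add, sub_zero, smul_eq_mul, fourier_coe_apply]
    convert h0 using 1
    rw [div_one, one_smul]
    refine setIntegral_congr_fun measurableSet_Ioc fun t _ => ?_
    simp [Φ])
  have hae' : ∀ᵐ y ∂(volume : Measure (AddCircle (1 : ℝ))),
      AddCircle.liftIoc (1 : ℝ) 0 Φ y = 0 := by
    rw [AddCircle.volume_eq_smul_haarAddCircle]
    exact Measure.ae_smul_measure hae _
  have h3 := (AddCircle.measurePreserving_mk (1 : ℝ) 0).quasiMeasurePreserving.ae hae'
  rw [zero_add] at h3
  filter_upwards [h3, ae_restrict_mem measurableSet_Ioc] with t ht hmem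
  rwa [AddCircle.liftIoc_coe_apply (by simpa using hmem)] at ht

theorem exists_eq_prod_sub_mul {ι : Type*} [DecidableEq ι] {U : Set ℂ} (hU : IsOpen U) {f : ℂ → ℂ}
    (hf : DifferentiableOn ℂ f U) (pt : ι → ℂ) (hinj : Function.Injective pt)
    (hmem : ∀ i, pt i ∈ U) (s : Finset ι) (h0 : ∀ i ∈ s, f (pt i) = 0) :
    ∃ g : ℂ → ℂ, DifferentiableOn ℂ g U ∧ ∀ z, f z = (∏ i ∈ s, (z - pt i)) * g z := by
  induction s using Finset.induction_on with
  | empty => exact ⟨f, hf, by simp⟩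
  | insert j s hj ih =>
    obtain ⟨g, hg, hfg⟩ := ih fun i hi => h0 i (Finset.mem_insert_of_mem hi)
    have hgj : g (pt j) = 0 := by
      have h1 := h0 j (Finset.mem_insert_self _ _)
      rw [hfg, mul_eq_zero, Finset.prod_eq_zero_iff] at h1
      refine h1.resolve_left ?_
      rintro ⟨i, hi, h⟩
      exact hj (hinj (sub_eq_zero.1 h) ▸ hi)
    refine ⟨dslope g (pt j), (Complex.differentiableOn_dslope (hU.mem_nhds (hmem j))).2 hg, ?_⟩
    intro z
    have h2 := sub_smul_dslope g (pt j) z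
    rw [hgj, sub_zero, smul_eq_mul] at h2
    rw [hfg, Finset.prod_insert hj, ← h2]
    ring

theorem summable_exp_neg_sq_add_abs {a : ℝ} (ha : 0 < a) (B : ℝ) :
    Summable fun n : ℤ => Real.exp (-a * (n : ℝ) ^ 2 + B * |(n : ℝ)|) := by
  have := summable_pow_mul_jacobiTheta₂_term_bound (B / (2 * π)) (div_pos ha Real.pi_pos) 0
  refine this.congr fun n => ?_
  rw [pow_zero, one_mul, Int.cast_abs]
  congr 1
  field_simp
  ring

theorem exists_tsum_gaussian_le {a : ℝ} (ha : 0 < a) : ∃ S : ℝ, 0 ≤ S ∧ ∀ Y : ℝ,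
    (Summable fun n : ℤ => Real.exp (-a * ((n : ℝ) - Y) ^ 2)) ∧
      ∑' n : ℤ, Real.exp (-a * ((n : ℝ) - Y) ^ 2) ≤ S := by
  have h0 := summable_exp_neg_sq_add_abs ha a
  refine ⟨∑' n : ℤ, Real.exp (-a * (n : ℝ) ^ 2 + a * |(n : ℝ)|),
    tsum_nonneg fun _ => (Real.exp_pos _).le, fun Y => ?_⟩
  have hY : ∀ n : ℤ, Real.exp (-a * (((Equiv.addRight (round Y) n : ℤ) : ℝ) - Y) ^ 2)
      ≤ Real.exp (-a * (n : ℝ) ^ 2 + a * |(n : ℝ)|) := by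
    intro n
    rw [Real.exp_le_exp]
    have h1 := abs_sub_round Y
    set e := Y - round Y with he
    have h2 : ((Equiv.addRight (round Y) n : ℤ) : ℝ) - Y = n - e := by
      simp [he]; ring
    rw [h2]
    have h3 : (n : ℝ) * e ≤ |(n : ℝ)| * (1 / 2) := by
      calc (n : ℝ) * e ≤ |(n : ℝ) * e| := le_abs_self _
        _ = |(n : ℝ)| * |e| := abs_mul _ _
        _ ≤ _ := by gcongr
    nlinarith [sq_nonneg e]
  have hs := Summable.of_nonneg_of_le (fun _ => (Real.exp_pos _).le) hY h0
  refine ⟨(Equiv.addRight (round Y)).summable_iff.1 hs, ?_⟩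
  rw [← (Equiv.addRight (round Y)).tsum_eq]
  exact hs.tsum_le_tsum hY h0

theorem norm_zpow_eq_exp {z : ℂ} (hz : z ≠ 0) (n : ℤ) :
    ‖z ^ n‖ = Real.exp (n * Real.log ‖z‖) := by
  rw [norm_zpow, mul_comm, Real.exp_mul, Real.exp_log (norm_pos_iff.2 hz), Real.rpow_intCast]

section

variable {a : ℝ} {c : ℤ → ℂ} {C : ℝ}

theorem norm_theta_term_le (ha : 0 < a) (hc : ∀ n, ‖c n‖ ≤ C) {z : ℂ} (hz : z ≠ 0) (n : ℤ) :
    ‖c n * (Real.exp (-a * (n : ℝ) ^ 2) : ℂ) * z ^ n‖ ≤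
      C * (Real.exp (a * (Real.log ‖z‖ / (2 * a)) ^ 2) *
        Real.exp (-a * ((n : ℝ) - Real.log ‖z‖ / (2 * a)) ^ 2)) := by
  rw [norm_mul, norm_mul, norm_zpow_eq_exp hz, Complex.norm_real, Real.norm_eq_abs, Real.abs_exp,
    mul_assoc, ← Real.exp_add, ← Real.exp_add]
  have h1 : -a * (n : ℝ) ^ 2 + n * Real.log ‖z‖ = a * (Real.log ‖z‖ / (2 * a)) ^ 2 +
      -a * ((n : ℝ) - Real.log ‖z‖ / (2 * a)) ^ 2 := by
    field_simp
    ring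
  rw [h1]
  exact mul_le_mul_of_nonneg_right (hc n) (Real.exp_pos _).le

theorem differentiableOn_theta_series (ha : 0 < a) (hc : ∀ n, ‖c n‖ ≤ C) :
    DifferentiableOn ℂ (fun z : ℂ => ∑' n : ℤ, c n * (Real.exp (-a * (n : ℝ) ^ 2) : ℂ) * z ^ n)
      {0}ᶜ := by
  have hC : 0 ≤ C := (norm_nonneg _).trans (hc 0)
  intro z hz
  have hz' : z ≠ 0 := hz
  set B := |Real.log ‖z‖| + 1 with hB
  have hcont : ContinuousOn (fun w : ℂ => |Real.log ‖w‖|) {0}ᶜ :=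
    (ContinuousOn.log continuous_norm.continuousOn fun w hw => norm_ne_zero_iff.2 hw).abs
  have hopen : IsOpen ({0}ᶜ ∩ (fun w : ℂ => |Real.log ‖w‖|) ⁻¹' Set.Iio B) :=
    hcont.isOpen_inter_preimage isOpen_compl_singleton isOpen_Iio
  have hd := differentiableOn_tsum_of_summable_norm
    (F := fun (n : ℤ) (z : ℂ) => c n * (Real.exp (-a * (n : ℝ) ^ 2) : ℂ) * z ^ n)
    ((summable_exp_neg_sq_add_abs ha B).mul_left C) ?_ hopen ?_
  · exact (hd.differentiableAt (hopen.mem_nhds ⟨hz, by simp [hB]⟩)).differentiableWithinAt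
  · intro n w hw
    exact ((differentiableAt_zpow.2 (Or.inl hw.1)).const_mul _).differentiableWithinAt
  · rintro n w ⟨hw, hwB⟩
    rw [norm_mul, norm_mul, norm_zpow_eq_exp hw, Complex.norm_real, Real.norm_eq_abs, Real.abs_exp,
      mul_assoc, ← Real.exp_add]
    refine mul_le_mul (hc n) (Real.exp_le_exp.2 ?_) (Real.exp_pos _).le hC
    have h1 : (n : ℝ) * Real.log ‖w‖ ≤ B * |(n : ℝ)| := by
      calc (n : ℝ) * Real.log ‖w‖ ≤ |(n : ℝ) * Real.log ‖w‖| := le_abs_self _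
        _ = |Real.log ‖w‖| * |(n : ℝ)| := by rw [abs_mul, mul_comm]
        _ ≤ _ := mul_le_mul_of_nonneg_right (le_of_lt hwB) (abs_nonneg _)
    linarith

theorem norm_theta_series_le (ha : 0 < a) (hc : ∀ n, ‖c n‖ ≤ C) {S : ℝ}
    (hS : ∀ Y : ℝ, (Summable fun n : ℤ => Real.exp (-a * ((n : ℝ) - Y) ^ 2)) ∧
      ∑' n : ℤ, Real.exp (-a * ((n : ℝ) - Y) ^ 2) ≤ S) {z : ℂ} (hz : z ≠ 0) :
    ‖∑' n : ℤ, c n * (Real.exp (-a * (n : ℝ) ^ 2) : ℂ) * z ^ n‖ ≤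
      C * S * Real.exp (a * (Real.log ‖z‖ / (2 * a)) ^ 2) := by
  have hC : 0 ≤ C := (norm_nonneg _).trans (hc 0)
  obtain ⟨h1, h2⟩ := hS (Real.log ‖z‖ / (2 * a))
  refine (tsum_of_norm_bounded ((h1.mul_left _).mul_left C).hasSum
    (norm_theta_term_le ha hc hz)).trans ?_
  rw [tsum_mul_left, tsum_mul_left, mul_assoc, mul_comm S]
  gcongr

end

/-- Lower bound, on the circles of radius `exp (±t (K + 1))`, for the factors vanishing at
`exp (±t (i + 1))`, `i < K`. -/
theorem le_norm_sub_exp_mul_norm_sub_exp {t : ℝ} (ht : 0 < t) {K i : ℕ} (hi : i < K) {z : ℂ}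
    (hz : ‖z‖ = Real.exp (t * (K + 1)) ∨ ‖z‖ = Real.exp (-(t * (K + 1)))) :
    (1 - Real.exp (-t)) ^ 2 * (Real.exp (t * (K + 1)) * ‖z‖) ≤
      ‖z - (Real.exp (t * (i + 1)) : ℂ)‖ * ‖z - (Real.exp (-(t * (i + 1))) : ℂ)‖ := by
  have hδ : 0 ≤ 1 - Real.exp (-t) := by
    rw [sub_nonneg, Real.exp_le_one_iff]; linarith
  have hiK : (i : ℝ) + 1 ≤ K := by exact_mod_cast hi
  have hi0 : (0 : ℝ) ≤ i := Nat.cast_nonneg i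
  have hn : ∀ x : ℝ, ‖((Real.exp x : ℝ) : ℂ)‖ = Real.exp x := fun x => by
    rw [Complex.norm_real, Real.norm_eq_abs, Real.abs_exp]
  have hfar : ∀ x y : ℝ, x + t ≤ y →
      (1 - Real.exp (-t)) * Real.exp y ≤ Real.exp y - Real.exp x := by
    intro x y hxy
    have : Real.exp x ≤ Real.exp (-t) * Real.exp y := by
      rw [← Real.exp_add, Real.exp_le_exp]; linarith
    linarith
  rcases hz with hz | hz
  · have h1 : (1 - Real.exp (-t)) * Real.exp (t * (K + 1)) ≤
        ‖z - (Real.exp (t * (i + 1)) : ℂ)‖ := by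
      refine (hfar (t * (i + 1)) _ (by nlinarith)).trans ?_
      have h := norm_sub_norm_le z ((Real.exp (t * (i + 1)) : ℝ) : ℂ)
      rwa [hn, hz] at h
    have h2 : (1 - Real.exp (-t)) * Real.exp (t * (K + 1)) ≤
        ‖z - (Real.exp (-(t * (i + 1))) : ℂ)‖ := by
      refine (hfar (-(t * (i + 1))) _ (by nlinarith)).trans ?_
      have h := norm_sub_norm_le z ((Real.exp (-(t * (i + 1))) : ℝ) : ℂ)
      rwa [hn, hz] at h
    rw [hz]
    calc _ = ((1 - Real.exp (-t)) * Real.exp (t * (K + 1))) *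
          ((1 - Real.exp (-t)) * Real.exp (t * (K + 1))) := by ring
      _ ≤ _ := mul_le_mul h1 h2 (by positivity) (norm_nonneg _)
  · have h1 : (1 - Real.exp (-t)) * Real.exp (t * (i + 1)) ≤
        ‖z - (Real.exp (t * (i + 1)) : ℂ)‖ := by
      refine (hfar (-(t * (K + 1))) _ (by nlinarith)).trans ?_
      have h := norm_sub_norm_le ((Real.exp (t * (i + 1)) : ℝ) : ℂ) z
      rwa [hn, hz, norm_sub_rev] at h
    have h2 : (1 - Real.exp (-t)) * Real.exp (-(t * (i + 1))) ≤
        ‖z - (Real.exp (-(t * (i + 1))) : ℂ)‖ := by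
      refine (hfar (-(t * (K + 1))) _ (by nlinarith)).trans ?_
      have h := norm_sub_norm_le ((Real.exp (-(t * (i + 1))) : ℝ) : ℂ) z
      rwa [hn, hz, norm_sub_rev] at h
    rw [hz, ← Real.exp_add, add_neg_cancel, Real.exp_zero, mul_one]
    calc (1 - Real.exp (-t)) ^ 2 = ((1 - Real.exp (-t)) * Real.exp (t * (i + 1))) *
          ((1 - Real.exp (-t)) * Real.exp (-(t * (i + 1)))) := by
          rw [mul_mul_mul_comm, ← Real.exp_add, add_neg_cancel, Real.exp_zero]; ring
      _ ≤ _ := mul_le_mul h1 h2 (by positivity) (norm_nonneg _)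

theorem prod_four_mul_exp (t : ℝ) (K : ℕ) :
    ∏ i ∈ Finset.range K, (4 * Real.exp (t * ((i : ℝ) + 1))) =
      4 ^ K * Real.exp (t * (K * (K + 1) / 2)) := by
  induction K with
  | zero => simp
  | succ K ih =>
    rw [Finset.prod_range_succ, ih, pow_succ, mul_mul_mul_comm, ← Real.exp_add]
    push_cast
    ring_nf

theorem norm_le_of_vanish_exp {a θ M : ℝ} (ha : 0 < a) (hθ : 0 < θ) {h : ℂ → ℂ}
    (hd : DifferentiableOn ℂ h {0}ᶜ)
    (hb : ∀ z ≠ 0, ‖h z‖ ≤ M * Real.exp (a * (Real.log ‖z‖ / (2 * a)) ^ 2))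
    (hv : ∀ k : ℤ, h (Real.exp (2 * a * θ * k) : ℂ) = 0) {z₀ : ℂ} (hz₀ : ‖z₀‖ = 1) (K : ℕ) :
    ‖h z₀‖ ≤ M * Real.exp (a * θ ^ 2 * (K + 1) ^ 2 - a * θ * K * (K + 1)) *
      (4 / (1 - Real.exp (-(2 * a * θ))) ^ 2) ^ K := by
  set t := 2 * a * θ with ht
  have ht0 : 0 < t := by positivity
  have hδ : 0 < 1 - Real.exp (-t) := by rw [sub_pos, Real.exp_lt_one_iff]; linarith
  set δ := 1 - Real.exp (-t) with hδdef
  let pt : ℕ × Bool → ℂ := fun i =>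
    (Real.exp (t * ((if i.2 then (i.1 + 1 : ℤ) else -(i.1 + 1 : ℤ) : ℤ) : ℝ)) : ℂ)
  have hinj : Function.Injective pt := by
    rintro ⟨i, b⟩ ⟨j, b'⟩ hij
    have h1 := Real.exp_injective (Complex.ofReal_injective hij)
    have h2 := Int.cast_injective (mul_left_cancel₀ ht0.ne' h1)
    rcases b with _ | _ <;> rcases b' with _ | _ <;> simp at h2 ⊢ <;> omega
  obtain ⟨g, hg, hhg⟩ := exists_eq_prod_sub_mul isOpen_compl_singleton hd pt hinj
    (fun i => by simp [pt, -Complex.ofReal_exp, Real.exp_ne_zero])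
    (Finset.range K ×ˢ Finset.univ) (fun i _ => hv _)
  have hnorm : ∀ z, ‖h z‖ = (∏ i ∈ Finset.range K, (‖z - (Real.exp (t * (i + 1)) : ℂ)‖ *
      ‖z - (Real.exp (-(t * (i + 1))) : ℂ)‖)) * ‖g z‖ := by
    intro z
    rw [hhg, norm_mul, norm_prod, Finset.prod_product]
    congr 1
    refine Finset.prod_congr rfl fun i _ => ?_
    rw [Fintype.prod_bool]
    simp only [pt, if_true, Bool.false_eq_true, if_false]
    push_cast
    congr 5
    ring
  set R := Real.exp (t * (K + 1)) with hR
  set V : Set ℂ := {z | Real.exp (-(t * (K + 1))) < ‖z‖ ∧ ‖z‖ < R} with hV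
  have hVo : IsOpen V := (isOpen_lt continuous_const continuous_norm).inter
    (isOpen_lt continuous_norm continuous_const)
  have hVb : Bornology.IsBounded V :=
    Metric.isBounded_ball.subset fun z hz => mem_ball_zero_iff.2 hz.2
  have hVc : closure V ⊆ {z | Real.exp (-(t * (K + 1))) ≤ ‖z‖ ∧ ‖z‖ ≤ R} :=
    closure_minimal (fun z hz => ⟨hz.1.le, hz.2.le⟩)
      ((isClosed_le continuous_const continuous_norm).inter
        (isClosed_le continuous_norm continuous_const))
  have hV0 : closure V ⊆ {0}ᶜ := fun z hz => by
    have := (hVc hz).1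
    exact norm_pos_iff.1 ((Real.exp_pos _).trans_le this)
  have hu : DiffContOnCl ℂ (fun z => g z * z ^ K) V :=
    ((hg.mul (differentiable_id.pow K).differentiableOn).mono hV0).diffContOnCl
  have hfr : ∀ z ∈ frontier V, ‖g z * z ^ K‖ ≤
      M * Real.exp (a * θ ^ 2 * (K + 1) ^ 2) / (δ ^ 2 * R) ^ K := by
    intro z hz
    have hzc := hVc hz.1
    have hz2 : ¬ z ∈ V := by
      have := hz.2
      rwa [hVo.interior_eq] at this
    have hzR : ‖z‖ = R ∨ ‖z‖ = Real.exp (-(t * (K + 1))) := by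
      by_contra! hne
      exact hz2 ⟨lt_of_le_of_ne hzc.1 hne.2.symm, lt_of_le_of_ne hzc.2 hne.1⟩
    have hlog : a * (Real.log ‖z‖ / (2 * a)) ^ 2 = a * θ ^ 2 * (K + 1) ^ 2 := by
      rcases hzR with hz | hz <;> rw [hz, Real.log_exp, ht] <;> field_simp
    have h1 := hb z (hV0 hz.1)
    rw [hlog] at h1
    rw [le_div_iff₀ (by positivity), norm_mul, norm_pow]
    refine le_trans ?_ h1
    rw [hnorm]
    calc ‖g z‖ * ‖z‖ ^ K * (δ ^ 2 * R) ^ K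
        = (∏ i ∈ Finset.range K, (δ ^ 2 * (R * ‖z‖))) * ‖g z‖ := by
          rw [Finset.prod_const, Finset.card_range, ← mul_assoc, mul_pow _ ‖z‖]; ring
      _ ≤ _ := by
          refine mul_le_mul_of_nonneg_right (Finset.prod_le_prod (fun i _ => by positivity)
            fun i hi => ?_) (norm_nonneg _)
          exact le_norm_sub_exp_mul_norm_sub_exp ht0 (Finset.mem_range.1 hi) hzR
  have hz₀V : z₀ ∈ closure V := by
    refine subset_closure ⟨?_, ?_⟩
    · rw [hz₀, Real.exp_lt_one_iff]; nlinarith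
    · rw [hz₀, hR, Real.one_lt_exp_iff]; positivity
  have hmax := Complex.norm_le_of_forall_mem_frontier_norm_le hVb hu hfr hz₀V
  rw [norm_mul, norm_pow, hz₀, one_pow, mul_one] at hmax
  have hD : ∏ i ∈ Finset.range K, (‖z₀ - (Real.exp (t * (i + 1)) : ℂ)‖ *
      ‖z₀ - (Real.exp (-(t * (i + 1))) : ℂ)‖) ≤ 4 ^ K * Real.exp (t * (K * (K + 1) / 2)) := by
    rw [← prod_four_mul_exp]
    refine Finset.prod_le_prod (fun i _ => by positivity) fun i _ => ?_
    have hn : ∀ x : ℝ, ‖z₀ - ((Real.exp x : ℝ) : ℂ)‖ ≤ 1 + Real.exp x := fun x => by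
      refine (norm_sub_le _ _).trans ?_
      rw [Complex.norm_real, Real.norm_eq_abs, Real.abs_exp, hz₀]
    have h1 : 1 ≤ Real.exp (t * ((i : ℝ) + 1)) := Real.one_le_exp (by positivity)
    have h2 : Real.exp (-(t * ((i : ℝ) + 1))) ≤ 1 := Real.exp_le_one_iff.2 (by
      have : 0 < t * ((i : ℝ) + 1) := by positivity
      linarith)
    calc _ ≤ (1 + Real.exp (t * (i + 1))) * (1 + Real.exp (-(t * (i + 1)))) :=
          mul_le_mul (hn _) (hn _) (norm_nonneg _) (by positivity)
      _ ≤ _ := by nlinarith [Real.exp_pos (-(t * ((i : ℝ) + 1)))]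
  rw [hnorm]
  refine (mul_le_mul hD hmax (norm_nonneg _) (by positivity)).trans (le_of_eq ?_)
  rw [mul_pow, hR, ← Real.exp_nat_mul, div_pow]
  have e1 : a * θ ^ 2 * ((K : ℝ) + 1) ^ 2 - a * θ * K * (K + 1) = t * (K * (K + 1) / 2) +
      a * θ ^ 2 * (K + 1) ^ 2 - K * (t * (K + 1)) := by rw [ht]; ring
  rw [e1, Real.exp_sub, Real.exp_add]
  field_simp

theorem eq_zero_of_vanish_exp {a θ M : ℝ} (ha : 0 < a) (hθ : 0 < θ) (hθ1 : θ < 1) {h : ℂ → ℂ}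
    (hd : DifferentiableOn ℂ h {0}ᶜ)
    (hb : ∀ z ≠ 0, ‖h z‖ ≤ M * Real.exp (a * (Real.log ‖z‖ / (2 * a)) ^ 2))
    (hv : ∀ k : ℤ, h (Real.exp (2 * a * θ * k) : ℂ) = 0) {z₀ : ℂ} (hz₀ : ‖z₀‖ = 1) :
    h z₀ = 0 := by
  have hδ : 0 < 1 - Real.exp (-(2 * a * θ)) := by
    rw [sub_pos, Real.exp_lt_one_iff]
    have : 0 < a * θ := by positivity
    linarith
  set D := 4 / (1 - Real.exp (-(2 * a * θ))) ^ 2 with hD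
  have hDpos : 0 < D := by positivity
  have hlim : Filter.Tendsto (fun K : ℕ => M * Real.exp (a * θ ^ 2 * ((K : ℝ) + 1) ^ 2 -
      a * θ * K * (K + 1)) * D ^ K) Filter.atTop (nhds 0) := by
    have h1 : ∀ K : ℕ, M * Real.exp (a * θ ^ 2 * ((K : ℝ) + 1) ^ 2 -
        a * θ * K * (K + 1)) * D ^ K = M * Real.exp (a * θ ^ 2 +
          K * ((2 * a * θ ^ 2 - a * θ + Real.log D) - (a * θ * (1 - θ)) * K)) := by
      intro K
      have : D ^ K = Real.exp (K * Real.log D) := by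
        rw [Real.exp_nat_mul, Real.exp_log hDpos]
      rw [this, mul_assoc, ← Real.exp_add]
      congr 2
      ring
    simp only [h1]
    rw [← mul_zero M]
    refine (Real.tendsto_exp_atBot.comp (Filter.tendsto_atBot_add_const_left _ _ ?_)).const_mul M
    refine Filter.Tendsto.atTop_mul_atBot₀ tendsto_natCast_atTop_atTop ?_
    simp only [sub_eq_add_neg]
    refine Filter.tendsto_atBot_add_const_left _ _ (Filter.tendsto_neg_atTop_atBot.comp ?_)
    have : 0 < 1 - θ := by linarith
    exact tendsto_natCast_atTop_atTop.const_mul_atTop (by positivity)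
  have := ge_of_tendsto' hlim fun K => norm_le_of_vanish_exp ha hθ hd hb hv hz₀ K
  exact norm_le_zero_iff.1 this

/-- Gaussian translates along a lattice finer than the integers determine bounded sequences. -/
theorem eq_zero_of_tsum_mul_gaussian {a θ C : ℝ} (ha : 0 < a) (hθ : 0 < θ) (hθ1 : θ < 1)
    {c : ℤ → ℂ} (hc : ∀ n, ‖c n‖ ≤ C)
    (h : ∀ k : ℤ, ∑' n : ℤ, c n * (Real.exp (-a * ((n : ℝ) - k * θ) ^ 2) : ℂ) = 0) : c = 0 := by
  obtain ⟨S, -, hS⟩ := exists_tsum_gaussian_le ha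
  have hv : ∀ k : ℤ, ∑' n : ℤ, c n * (Real.exp (-a * (n : ℝ) ^ 2) : ℂ) *
      (Real.exp (2 * a * θ * k) : ℂ) ^ n = 0 := by
    intro k
    rw [← mul_zero (Real.exp (a * (k * θ) ^ 2) : ℂ), ← h k, ← tsum_mul_left]
    refine tsum_congr fun n => ?_
    rw [← Complex.ofReal_zpow, ← Real.rpow_intCast, ← Real.exp_mul, mul_left_comm, mul_assoc,
      ← Complex.ofReal_mul, ← Complex.ofReal_mul, ← Real.exp_add, ← Real.exp_add]
    congr 3
    ring
  have hs : Summable fun n : ℤ => ‖c n * (Real.exp (-a * (n : ℝ) ^ 2) : ℂ)‖ := by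
    refine Summable.of_nonneg_of_le (fun _ => norm_nonneg _) (fun n => ?_)
      ((hS 0).1.mul_left C)
    rw [norm_mul, Complex.norm_real, Real.norm_eq_abs, Real.abs_exp, sub_zero]
    exact mul_le_mul_of_nonneg_right (hc n) (Real.exp_pos _).le
  have h0 := eq_zero_of_hasSum_fourier hs fun t => by
    have := eq_zero_of_vanish_exp ha hθ hθ1 (differentiableOn_theta_series ha hc)
      (fun z hz => norm_theta_series_le ha hc hS hz) hv
      (z₀ := Complex.exp ((2 * π * t : ℝ) * I)) (Complex.norm_exp_ofReal_mul_I _)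
    rw [← this]
    refine tsum_congr fun n => ?_
    rw [← Complex.exp_int_mul]
    congr 2
    push_cast
    ring
  funext n
  have := congrFun h0 n
  simpa [Complex.exp_ne_zero] using this

theorem Polynomial.exists_norm_eval_le_mul_exp (Q : Polynomial ℂ) :
    ∃ C : ℝ, 0 ≤ C ∧ ∀ z : ℂ, ‖Q.eval z‖ ≤ C * Real.exp ‖z‖ := by
  induction Q using Polynomial.induction_on' with
  | add P Q hP hQ =>
    obtain ⟨C, hC, hP⟩ := hP
    obtain ⟨D, hD, hQ⟩ := hQ
    refine ⟨C + D, add_nonneg hC hD, fun z => ?_⟩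
    rw [Polynomial.eval_add, add_mul]
    exact (norm_add_le _ _).trans (add_le_add (hP z) (hQ z))
  | monomial n b =>
    refine ⟨‖b‖ * n.factorial, by positivity, fun z => ?_⟩
    rw [Polynomial.eval_monomial, norm_mul, norm_pow, mul_assoc]
    refine mul_le_mul_of_nonneg_left ?_ (norm_nonneg _)
    have := Real.pow_div_factorial_le_exp ‖z‖ (norm_nonneg _) n
    rwa [div_le_iff₀' (by positivity)] at this

/-- The entire function `z ↦ Q z * exp (-a z ^ 2)`. -/
noncomputable def polyGauss (Q : Polynomial ℂ) (a : ℝ) (z : ℂ) : ℂ :=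
  Q.eval z * Complex.exp (-a * z ^ 2)

/-- The Zak transform with step `p` of `polyGauss Q a`, at complex arguments. -/
noncomputable def zakSum (Q : Polynomial ℂ) (a : ℝ) (p : ℕ) (z ξ : ℂ) : ℂ :=
  ∑' j : ℤ, polyGauss Q a (z + p * j) * Complex.exp (I * ξ * j)

theorem differentiable_polyGauss (Q : Polynomial ℂ) (a : ℝ) :
    Differentiable ℂ (polyGauss Q a) := by
  unfold polyGauss
  exact Q.differentiable.mul (by fun_prop)

theorem exists_norm_zakSum_term_le (Q : Polynomial ℂ) {a : ℝ} (ha : 0 < a) {p : ℕ} (hp : 0 < p)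
    (R : ℝ) : ∃ u : ℤ → ℝ, Summable u ∧ ∀ j : ℤ, ∀ z ξ : ℂ, ‖z‖ ≤ R → ‖ξ‖ ≤ R →
      ‖polyGauss Q a (z + p * j) * Complex.exp (I * ξ * j)‖ ≤ u j := by
  obtain ⟨C, hC, hQ⟩ := Q.exists_norm_eval_le_mul_exp
  have hap : 0 < a * (p : ℝ) ^ 2 := by positivity
  refine ⟨fun j => C * Real.exp (R + a * R ^ 2) *
    Real.exp (-(a * (p : ℝ) ^ 2) * (j : ℝ) ^ 2 + (p + 2 * a * p * R + R) * |(j : ℝ)|),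
    (summable_exp_neg_sq_add_abs hap _).mul_left _, fun j z ξ hz hξ => ?_⟩
  have hR : 0 ≤ R := (norm_nonneg _).trans hz
  rw [polyGauss, norm_mul, norm_mul, Complex.norm_exp, Complex.norm_exp]
  have h1 : ‖Q.eval (z + p * j)‖ ≤ C * Real.exp (R + p * |(j : ℝ)|) := by
    refine (hQ _).trans (mul_le_mul_of_nonneg_left (Real.exp_le_exp.2 ?_) hC)
    refine (norm_add_le _ _).trans (add_le_add hz (le_of_eq ?_))
    simp
  have h2 : (-(a : ℂ) * (z + p * j) ^ 2).re ≤
      a * R ^ 2 - a * (p : ℝ) ^ 2 * (j : ℝ) ^ 2 + 2 * a * p * R * |(j : ℝ)| := by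
    have e : (-(a : ℂ) * (z + p * j) ^ 2).re = -a * (z.re ^ 2 - z.im ^ 2) -
        2 * a * p * (z.re * j) - a * (p : ℝ) ^ 2 * (j : ℝ) ^ 2 := by
      simp [pow_two]
      ring
    have h3 : z.im ^ 2 ≤ R ^ 2 := by
      rw [← sq_abs z.im]; gcongr; exact (Complex.abs_im_le_norm z).trans hz
    have h4 : -(z.re * j) ≤ R * |(j : ℝ)| := by
      refine (neg_le_abs _).trans ?_
      rw [abs_mul]; gcongr; exact (Complex.abs_re_le_norm z).trans hz
    have h5 : 2 * a * p * (-(z.re * j)) ≤ 2 * a * p * (R * |(j : ℝ)|) := by gcongr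
    rw [e]
    nlinarith [sq_nonneg z.re]
  have h3 : (I * ξ * j).re ≤ R * |(j : ℝ)| := by
    have e : (I * ξ * j).re = -(ξ.im * j) := by simp
    rw [e]
    refine (neg_le_abs _).trans ?_
    rw [abs_mul]; gcongr; exact (Complex.abs_im_le_norm ξ).trans hξ
  calc _ ≤ C * Real.exp (R + p * |(j : ℝ)|) * Real.exp (a * R ^ 2 - a * (p : ℝ) ^ 2 * (j : ℝ) ^ 2
        + 2 * a * p * R * |(j : ℝ)|) * Real.exp (R * |(j : ℝ)|) := by gcongr
    _ = _ := by
      simp only [mul_assoc C, ← Real.exp_add]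
      congr 2
      ring

theorem summable_norm_zakSum (Q : Polynomial ℂ) {a : ℝ} (ha : 0 < a) {p : ℕ} (hp : 0 < p)
    (z ξ : ℂ) : Summable fun j : ℤ => ‖polyGauss Q a (z + p * j) * Complex.exp (I * ξ * j)‖ := by
  obtain ⟨u, hu, h⟩ := exists_norm_zakSum_term_le Q ha hp (max ‖z‖ ‖ξ‖)
  exact Summable.of_nonneg_of_le (fun _ => norm_nonneg _)
    (fun j => h j z ξ (le_max_left _ _) (le_max_right _ _)) hu

theorem differentiable_zakSum_comp (Q : Polynomial ℂ) {a : ℝ} (ha : 0 < a) {p : ℕ} (hp : 0 < p)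
    {φ ψ : ℂ → ℂ} (hφ : Differentiable ℂ φ) (hψ : Differentiable ℂ ψ) :
    Differentiable ℂ fun t => zakSum Q a p (φ t) (ψ t) := by
  intro t
  set R := max ‖φ t‖ ‖ψ t‖ + 1 with hR
  obtain ⟨u, hu, h⟩ := exists_norm_zakSum_term_le Q ha hp R
  have hopen : IsOpen {t | ‖φ t‖ < R ∧ ‖ψ t‖ < R} :=
    (isOpen_lt hφ.continuous.norm continuous_const).inter
      (isOpen_lt hψ.continuous.norm continuous_const)
  have hd := differentiableOn_tsum_of_summable_norm
    (F := fun (j : ℤ) (t : ℂ) => polyGauss Q a (φ t + p * j) * Complex.exp (I * ψ t * j))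
    hu (fun j => ?_) hopen (fun j w hw => h j _ _ hw.1.le hw.2.le)
  · refine hd.differentiableAt (hopen.mem_nhds ⟨?_, ?_⟩)
    · exact (le_max_left _ _).trans_lt (lt_add_one _)
    · exact (le_max_right _ _).trans_lt (lt_add_one _)
  · have h1 := (differentiable_polyGauss Q a).comp (hφ.add_const ((p : ℂ) * j))
    exact (h1.mul (by fun_prop)).differentiableOn

theorem tsum_int_eq_sum_fin {p : ℕ} [NeZero p] {f : ℤ → ℂ} (hf : Summable f) :
    ∑' n : ℤ, f n = ∑ s : Fin p, ∑' j : ℤ, f (p * j + (s : ℕ)) := by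
  rw [← (Int.divModEquiv p).symm.tsum_eq]
  have h1 : Summable fun x : ℤ × Fin p => f ((Int.divModEquiv p).symm x) :=
    (Int.divModEquiv p).symm.summable_iff.2 hf
  rw [← (Equiv.prodComm (Fin p) ℤ).tsum_eq]
  have h2 : Summable fun x : Fin p × ℤ => f ((Int.divModEquiv p).symm (x.2, x.1)) :=
    (Equiv.prodComm (Fin p) ℤ).summable_iff.2 h1
  refine (h2.tsum_prod' fun s => h2.comp_injective (Prod.mk_right_injective s)).trans ?_
  rw [tsum_fintype]
  refine Finset.sum_congr rfl fun s _ => tsum_congr fun j => ?_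
  simp [Int.divModEquiv, mul_comm]

/-- The Zibulski–Zeevi type matrix of `polyGauss Q a` for the lattice of density `p / q`. -/
noncomputable def zakMatrix (Q : Polynomial ℂ) (a : ℝ) (p q : ℕ) (x ξ : ℂ) :
    Matrix (Fin q) (Fin p) ℂ :=
  Matrix.of fun r s => zakSum Q a p (x + (s : ℕ) - (r : ℕ) * (p / q : ℝ)) ξ

theorem summable_gaussian_of_bounded {a C : ℝ} (ha : 0 < a) {c : ℤ → ℂ} (hc : ∀ n, ‖c n‖ ≤ C)
    (Y : ℝ) : Summable fun n : ℤ => c n * (Real.exp (-a * ((n : ℝ) - Y) ^ 2) : ℂ) := by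
  obtain ⟨S, -, hS⟩ := exists_tsum_gaussian_le ha
  refine Summable.of_norm_bounded ((hS Y).1.mul_left C) fun n => ?_
  rw [norm_mul, Complex.norm_real, Real.norm_eq_abs, Real.abs_exp]
  exact mul_le_mul_of_nonneg_right (hc n) (Real.exp_pos _).le

theorem zakMatrix_one_mulVec_injective {a : ℝ} (ha : 0 < a) {p q : ℕ} (hp : 0 < p) (hpq : p ≤ q)
    (hco : p.Coprime q) {v : Fin p → ℂ} (hv : (zakMatrix 1 a p q 0 0).mulVec v = 0) : v = 0 := by
  have : NeZero p := ⟨hp.ne'⟩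
  have hq : 0 < q := hp.trans_le hpq
  have hq' : (q : ℝ) ≠ 0 := by positivity
  set θ : ℝ := p / q with hθdef
  have hθ : 0 < θ := by positivity
  set c : ℤ → ℂ := fun n => v (Int.divModEquiv p n).2 with hc
  have hcs : ∀ (s : Fin p) (j : ℤ), c (p * j + (s : ℕ)) = v s := by
    intro s j
    have : (Int.divModEquiv p) (p * j + (s : ℕ)) = (j, s) := by
      rw [← Equiv.eq_symm_apply]
      simp [Int.divModEquiv, mul_comm]
    simp only [hc, this]
  have hper : ∀ n m : ℤ, c (n + p * m) = c n := by
    intro n m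
    obtain ⟨⟨j, s⟩, rfl⟩ := (Int.divModEquiv p).symm.surjective n
    have e : (Int.divModEquiv p).symm (j, s) = p * j + (s : ℕ) := by
      simp [Int.divModEquiv, mul_comm]
    rw [e, hcs, ← hcs s (j + m)]
    congr 1
    ring
  have hbd : ∀ n, ‖c n‖ ≤ ‖v‖ := fun n => norm_le_pi_norm v _
  have hzero : ∀ r : Fin q, ∑' n : ℤ, c n * (Real.exp (-a * ((n : ℝ) - r * θ) ^ 2) : ℂ) = 0 := by
    intro r
    have h1 := congrFun hv r
    rw [tsum_int_eq_sum_fin (p := p) (summable_gaussian_of_bounded ha hbd _)]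
    refine Eq.trans ?_ h1
    simp only [Matrix.mulVec, dotProduct]
    refine Finset.sum_congr rfl fun s _ => ?_
    simp only [hcs, tsum_mul_left]
    rw [mul_comm]
    congr 1
    refine tsum_congr fun j => ?_
    simp only [polyGauss, Polynomial.eval_one]
    push_cast
    simp [hθdef]
    ring_nf
  have hall : ∀ k : ℤ, ∑' n : ℤ, c n * (Real.exp (-a * ((n : ℝ) - k * θ) ^ 2) : ℂ) = 0 := by
    intro k
    have : NeZero q := ⟨hq.ne'⟩
    obtain ⟨⟨m, r⟩, rfl⟩ := (Int.divModEquiv q).symm.surjective k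
    rw [← hzero r, ← (Equiv.addRight ((p : ℤ) * m)).tsum_eq]
    refine tsum_congr fun n => ?_
    rw [Equiv.coe_addRight, hper]
    congr 5
    simp [Int.divModEquiv, hθdef]
    field_simp
    ring
  suffices c = 0 by
    funext s
    rw [← hcs s 0, this, Pi.zero_apply, Pi.zero_apply]
  rcases hpq.lt_or_eq with hlt | rfl
  · refine eq_zero_of_tsum_mul_gaussian ha hθ ?_ hbd hall
    rw [hθdef, div_lt_one (by positivity)]
    exact_mod_cast hlt
  · obtain rfl : p = 1 := by simpa using hco
    have hconst : ∀ n, c n = c 0 := fun n => by simpa using hper 0 n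
    have h0 := hall 0
    simp only [hconst, tsum_mul_left] at h0
    rw [← Complex.ofReal_tsum, mul_eq_zero] at h0
    funext n
    rw [hconst, Pi.zero_apply]
    refine h0.resolve_right ?_
    obtain ⟨S, -, hS⟩ := exists_tsum_gaussian_le ha
    have := (hS ((0 : ℤ) * θ)).1.tsum_pos (fun _ => (Real.exp_pos _).le) 0 (Real.exp_pos _)
    exact_mod_cast this.ne'

theorem Polynomial.exists_norm_eval_le_mul_pow (Q : Polynomial ℂ) :
    ∃ C : ℝ, 0 ≤ C ∧ ∀ z : ℂ, ‖Q.eval z‖ ≤ C * (1 + ‖z‖) ^ Q.natDegree := by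
  refine ⟨∑ k ∈ Finset.range (Q.natDegree + 1), ‖Q.coeff k‖,
    Finset.sum_nonneg fun _ _ => norm_nonneg _, fun z => ?_⟩
  rw [Polynomial.eval_eq_sum_range, Finset.sum_mul]
  refine norm_sum_le_of_le _ fun k hk => ?_
  rw [norm_mul, norm_pow]
  refine mul_le_mul_of_nonneg_left ?_ (norm_nonneg _)
  refine (pow_le_pow_left₀ (norm_nonneg _) (le_add_of_nonneg_left zero_le_one) k).trans ?_
  exact pow_le_pow_right₀ (le_add_of_nonneg_right (norm_nonneg _))
    (Nat.lt_succ_iff.1 (Finset.mem_range.1 hk))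

/-- Far translates of a polynomial, normalised, converge to the leading coefficient. -/
theorem Polynomial.tendsto_inv_pow_mul_eval_add (Q : Polynomial ℂ) {ι : Type*} {l : Filter ι}
    {y : ι → ℂ} (hy0 : ∀ i, y i ≠ 0) (hy : Filter.Tendsto (fun i => (y i)⁻¹) l (nhds 0)) (v : ℂ) :
    Filter.Tendsto (fun i => (y i)⁻¹ ^ Q.natDegree * Q.eval (v + y i)) l
      (nhds Q.leadingCoeff) := by
  have h1 : ∀ i, (y i)⁻¹ ^ Q.natDegree * Q.eval (v + y i) =
      ((Q.taylor v).reverse).eval (y i)⁻¹ := by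
    intro i
    let _ := invertibleOfNonzero (hy0 i)
    have h2 := Polynomial.eval₂_reverse_mul_pow (RingHom.id ℂ) (y i) (Q.taylor v)
    rw [invOf_eq_inv, Polynomial.natDegree_taylor, Polynomial.eval₂_id, Polynomial.eval₂_id,
      Polynomial.taylor_eval] at h2
    rw [add_comm v, ← h2, inv_pow, mul_comm, mul_inv_cancel_right₀ (pow_ne_zero _ (hy0 i))]
  simp only [h1]
  have h2 := (((Q.taylor v).reverse).continuous.tendsto 0).comp hy
  have h3 : ((Q.taylor v).reverse).eval 0 = Q.leadingCoeff := by
    rw [← Polynomial.coeff_zero_eq_eval_zero, Polynomial.coeff_zero_reverse]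
    simp
  rwa [h3] at h2

theorem zakMatrix_entry_shift (Q : Polynomial ℂ) {a : ℝ} (ha : 0 < a) {p : ℕ} (hp : 0 < p)
    (u : ℂ) {y : ℂ} {m : ℕ} (hy : y = m * (π / (a * p) * I)) : zakSum Q a p (y + u) 0 =
      Complex.exp (-a * y ^ 2) * Complex.exp (-(2 * a * y * u)) *
      ∑' j : ℤ, Q.eval (u + p * j + y) * Complex.exp (-a * (u + p * j) ^ 2) := by
  rw [zakSum, ← tsum_mul_left]
  refine tsum_congr fun j => ?_
  have ha' : (a : ℂ) ≠ 0 := by exact_mod_cast ha.ne'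
  have hp' : (p : ℂ) ≠ 0 := by exact_mod_cast hp.ne'
  have h1 : Complex.exp (-a * (y + u + p * j) ^ 2) = Complex.exp (-a * y ^ 2) *
      Complex.exp (-(2 * a * y * u)) * Complex.exp (-a * (u + p * j) ^ 2) := by
    rw [← Complex.exp_add, ← Complex.exp_add, Complex.exp_eq_exp_iff_exists_int]
    refine ⟨-(m * j), ?_⟩
    rw [hy]
    push_cast
    field_simp
    ring
  rw [polyGauss, h1, mul_zero, zero_mul, Complex.exp_zero, mul_one,
    show y + u + p * j = u + p * j + y by ring]
  ring

theorem tendsto_inv_pow_mul_tsum (Q : Polynomial ℂ) {a : ℝ} (ha : 0 < a) {p : ℕ} (hp : 0 < p)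
    {y : ℕ → ℂ} (hy1 : ∀ m, 1 ≤ ‖y m‖)
    (hy : Filter.Tendsto (fun i => (y i)⁻¹) Filter.atTop (nhds 0)) (u : ℝ) :
    Filter.Tendsto (fun m => ∑' j : ℤ, (y m)⁻¹ ^ Q.natDegree * (Q.eval (u + p * j + y m) *
        Complex.exp (-a * (u + p * j) ^ 2))) Filter.atTop
      (nhds (Q.leadingCoeff * zakSum 1 a p u 0)) := by
  obtain ⟨C, hC, hQ⟩ := Q.exists_norm_eval_le_mul_pow
  set d := Q.natDegree
  rw [zakSum, ← tsum_mul_left]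
  let Q' : Polynomial ℂ := (Polynomial.C 4 * (1 + Polynomial.X ^ 2)) ^ d
  have hs := (summable_norm_zakSum Q' ha hp u 0).mul_left C
  refine tendsto_tsum_of_dominated_convergence hs (fun j => ?_)
    (Filter.Eventually.of_forall fun m j => ?_)
  · simp only [← mul_assoc]
    have h1 := (Q.tendsto_inv_pow_mul_eval_add
      (fun m => norm_pos_iff.1 (zero_lt_one.trans_le (hy1 m))) hy (u + p * j)).mul_const
        (Complex.exp (-a * (u + p * j) ^ 2))
    convert h1 using 2
    simp [polyGauss]
  · simp only [polyGauss, mul_zero, zero_mul, Complex.exp_zero, mul_one]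
    rw [← mul_assoc, norm_mul, norm_mul, norm_mul, ← mul_assoc]
    refine mul_le_mul_of_nonneg_right ?_ (norm_nonneg _)
    obtain ⟨v, hv⟩ : ∃ v : ℝ, (u + p * j : ℂ) = v := ⟨u + p * j, by push_cast; rfl⟩
    have e : ‖Q'.eval (u + p * j : ℂ)‖ = (4 * (1 + v ^ 2)) ^ d := by
      have : Q'.eval (u + p * j : ℂ) = (((4 * (1 + v ^ 2)) ^ d : ℝ) : ℂ) := by
        rw [hv]; simp [Q']
      rw [this, Complex.norm_real, Real.norm_of_nonneg (by positivity)]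
    rw [e, hv, norm_pow, norm_inv]
    have h0 : 0 < ‖y m‖ := zero_lt_one.trans_le (hy1 m)
    calc ‖y m‖⁻¹ ^ d * ‖Q.eval (v + y m)‖ ≤ ‖y m‖⁻¹ ^ d * (C * (1 + ‖v + y m‖) ^ d) := by
          gcongr; exact hQ _
      _ = C * (‖y m‖⁻¹ * (1 + ‖v + y m‖)) ^ d := by rw [mul_pow]; ring
      _ ≤ C * (4 * (1 + v ^ 2)) ^ d := by
          refine mul_le_mul_of_nonneg_left (pow_le_pow_left₀ (by positivity) ?_ d) hC
          rw [inv_mul_le_iff₀ h0]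
          have h1 := norm_add_le (v : ℂ) (y m)
          rw [Complex.norm_real, Real.norm_eq_abs] at h1
          have h2 : |v| ≤ 1 + v ^ 2 := by
            have := sq_abs v
            nlinarith [sq_nonneg (|v| - 1)]
          nlinarith [hy1 m, sq_nonneg v]

theorem Matrix.exists_left_inverse_of_mulVec_eq_zero {m n : Type*} [Fintype m] [Fintype n]
    [DecidableEq m] [DecidableEq n] (A : Matrix m n ℂ) (h : ∀ v, A.mulVec v = 0 → v = 0) :
    ∃ L : Matrix n m ℂ, L * A = 1 := by
  obtain ⟨g, hg⟩ := A.mulVecLin.exists_leftInverse_of_injective (LinearMap.ker_eq_bot'.2 h)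
  refine ⟨LinearMap.toMatrix' g, ?_⟩
  have := congrArg LinearMap.toMatrix' hg
  rw [LinearMap.toMatrix'_comp, LinearMap.toMatrix'_id] at this
  rwa [← Matrix.toLin'_apply', LinearMap.toMatrix'_toLin'] at this

theorem exists_zakMatrix_left_inverse {Q : Polynomial ℂ} (hQ : Q ≠ 0) {a : ℝ} (ha : 0 < a)
    {p q : ℕ} (hp : 0 < p) (hpq : p ≤ q) (hco : p.Coprime q) :
    ∃ x : ℂ, ∃ L : Matrix (Fin p) (Fin q) ℂ, L * zakMatrix Q a p q x 0 = 1 := by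
  obtain ⟨L, hL⟩ := (zakMatrix 1 a p q 0 0).exists_left_inverse_of_mulVec_eq_zero
    fun v hv => zakMatrix_one_mulVec_injective ha hp hpq hco hv
  set t : ℝ := π / (a * p) with ht
  have ht0 : 0 < t := by have := Real.pi_pos; positivity
  obtain ⟨m₀, hm₀⟩ := exists_nat_gt t⁻¹
  set y : ℕ → ℂ := fun m => ((m + m₀ : ℕ) : ℂ) * (π / (a * p) * I) with hy
  have hyn : ∀ m, ‖y m‖ = (m + m₀) * t := by
    intro m
    have : y m = (((m + m₀) * t : ℝ) : ℂ) * I := by simp [hy, ht]; ring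
    rw [this, norm_mul, Complex.norm_I, mul_one, Complex.norm_real,
      Real.norm_of_nonneg (by positivity)]
  have hy1 : ∀ m, 1 ≤ ‖y m‖ := by
    intro m
    rw [hyn]
    have h1 : 1 ≤ m₀ * t := by
      rw [inv_lt_iff_one_lt_mul₀ ht0] at hm₀; exact hm₀.le
    nlinarith [(Nat.cast_nonneg m : (0 : ℝ) ≤ m)]
  have hylim : Filter.Tendsto (fun m => (y m)⁻¹) Filter.atTop (nhds 0) := by
    refine Filter.tendsto_inv₀_cobounded.comp ?_
    rw [← tendsto_norm_atTop_iff_cobounded]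
    simp only [hyn]
    exact (Filter.tendsto_atTop_add_const_right _ _ tendsto_natCast_atTop_atTop).atTop_mul_const ht0
  let N : ℕ → Matrix (Fin q) (Fin p) ℂ := fun m => Matrix.of fun r s =>
    ∑' j : ℤ, (y m)⁻¹ ^ Q.natDegree * (Q.eval (((s - r * (p / q : ℝ) : ℝ) : ℂ) + p * j + y m) *
        Complex.exp (-a * (((s - r * (p / q : ℝ) : ℝ) : ℂ) + p * j) ^ 2))
  have hN : Filter.Tendsto N Filter.atTop (nhds (Q.leadingCoeff • zakMatrix 1 a p q 0 0)) := by
    refine tendsto_pi_nhds.2 fun r => tendsto_pi_nhds.2 fun s => ?_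
    have := tendsto_inv_pow_mul_tsum Q ha hp hy1 hylim (s - r * (p / q : ℝ) : ℝ)
    have h1 : (Q.leadingCoeff • zakMatrix 1 a p q 0 0) r s =
        Q.leadingCoeff * zakSum 1 a p (s - r * (p / q : ℝ) : ℝ) 0 := by
      simp only [Matrix.smul_apply, zakMatrix, Matrix.of_apply, smul_eq_mul]
      congr 2
      push_cast
      ring
    rw [h1]
    exact this
  have hdet : Filter.Tendsto (fun m => (L * N m).det) Filter.atTop
      (nhds (L * (Q.leadingCoeff • zakMatrix 1 a p q 0 0)).det) :=
    ((Continuous.matrix_det (continuous_const.matrix_mul continuous_id)).tendsto _).comp hN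
  rw [Matrix.mul_smul, hL, Matrix.det_smul, Matrix.det_one, mul_one] at hdet
  obtain ⟨m, hm⟩ := (hdet.eventually_ne
    (pow_ne_zero _ (Polynomial.leadingCoeff_ne_zero.2 hQ))).exists
  refine ⟨y m, Matrix.exists_left_inverse_of_mulVec_eq_zero _ fun v hv => ?_⟩
  have hy0 : y m ≠ 0 := norm_pos_iff.1 (zero_lt_one.trans_le (hy1 m))
  set w : Fin p → ℂ := fun s => Complex.exp (-(2 * a * y m * s)) * v s with hw
  have hNw : (N m).mulVec w = 0 := by
    funext r
    have h1 := congrFun hv r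
    have h2 : (N m).mulVec w r = (y m)⁻¹ ^ Q.natDegree * Complex.exp (a * y m ^ 2) *
        Complex.exp (-(2 * a * y m * (r * (p / q : ℝ)))) *
          (zakMatrix Q a p q (y m) 0).mulVec v r := by
      simp only [Matrix.mulVec, dotProduct]
      rw [Finset.mul_sum]
      refine Finset.sum_congr rfl fun s _ => ?_
      have h3 := zakMatrix_entry_shift Q ha hp ((s - r * (p / q : ℝ) : ℝ) : ℂ) (y := y m) rfl
      have h4 : zakMatrix Q a p q (y m) 0 r s =
          zakSum Q a p (y m + ((s - r * (p / q : ℝ) : ℝ) : ℂ)) 0 := by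
        simp only [zakMatrix, Matrix.of_apply]
        congr 1
        push_cast
        ring
      rw [h4, h3]
      simp only [N, Matrix.of_apply, tsum_mul_left, hw]
      set S := ∑' j : ℤ, Q.eval (((s - r * (p / q : ℝ) : ℝ) : ℂ) + p * j + y m) *
        Complex.exp (-a * (((s - r * (p / q : ℝ) : ℝ) : ℂ) + p * j) ^ 2)
      have h5 : Complex.exp (a * y m ^ 2) * Complex.exp (-(2 * a * y m * (r * (p / q : ℝ)))) *
          (Complex.exp (-a * y m ^ 2) *
            Complex.exp (-(2 * a * y m * ((s - r * (p / q : ℝ) : ℝ) : ℂ)))) =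
          Complex.exp (-(2 * a * y m * s)) := by
        simp only [← Complex.exp_add]
        congr 1
        push_cast
        ring
      rw [← h5]
      ring
    rw [h2, h1]
    simp
  have hw0 : w = 0 := by
    have h3 : (L * N m).mulVec w = 0 := by rw [← Matrix.mulVec_mulVec, hNw, Matrix.mulVec_zero]
    exact Matrix.eq_zero_of_mulVec_eq_zero hm h3
  funext s
  have := congrFun hw0 s
  simpa [hw, Complex.exp_ne_zero] using this

theorem Differentiable.countable_zeros {f : ℂ → ℂ} (hf : Differentiable ℂ f) {z₀ : ℂ}
    (h : f z₀ ≠ 0) : {z | f z = 0}.Countable := by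
  have h1 := AnalyticOnNhd.preimage_zero_mem_codiscrete (fun z _ => hf.analyticAt z) h
  have h2 := (mem_codiscrete'.1 h1).2
  have h3 := (HereditarilyLindelofSpace.isLindelof _).countable_of_isDiscrete h2
  exact h3.mono fun z hz => by simpa using hz

theorem exists_countable_zakMatrix_injective {Q : Polynomial ℂ} (hQ : Q ≠ 0) {a : ℝ} (ha : 0 < a)
    {p q : ℕ} (hp : 0 < p) (hpq : p ≤ q) (hco : p.Coprime q) :
    ∃ X : Set ℂ, X.Countable ∧ ∀ x ∉ X, ∃ Y : Set ℂ, Y.Countable ∧ ∀ ξ ∉ Y, ∀ v,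
      (zakMatrix Q a p q x ξ).mulVec v = 0 → v = 0 := by
  obtain ⟨x₀, L, hL⟩ := exists_zakMatrix_left_inverse hQ ha hp hpq hco
  have hdiff : ∀ φ ψ : ℂ → ℂ, Differentiable ℂ φ → Differentiable ℂ ψ →
      Differentiable ℂ fun t => (L * zakMatrix Q a p q (φ t) (ψ t)).det := by
    intro φ ψ hφ hψ
    simp only [Matrix.det_apply, Matrix.mul_apply, zakMatrix, Matrix.of_apply]
    refine Differentiable.fun_sum fun σ _ => Differentiable.const_smul ?_ _
    refine Differentiable.fun_finsetProd fun i _ => Differentiable.fun_sum fun r _ => ?_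
    exact (differentiable_zakSum_comp Q ha hp ((hφ.add_const _).sub_const _) hψ).const_mul _
  refine ⟨{x | (L * zakMatrix Q a p q x 0).det = 0},
    (hdiff id (fun _ => 0) differentiable_id (differentiable_const _)).countable_zeros
      (z₀ := x₀) ?_, fun x hx => ⟨{ξ | (L * zakMatrix Q a p q x ξ).det = 0},
    (hdiff (fun _ => x) id (differentiable_const _) differentiable_id).countable_zeros
      (z₀ := 0) hx, fun ξ hξ v hv => ?_⟩⟩
  · simp [hL]
  · refine Matrix.eq_zero_of_mulVec_eq_zero hξ ?_
    rw [← Matrix.mulVec_mulVec, hv, Matrix.mulVec_zero]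

/-- The absolutely convergent Fourier series whose coefficients sample `polyGauss Q a` on
`z + p ℤ`. -/
noncomputable def zakFourier (Q : Polynomial ℂ) (a : ℝ) (p : ℕ) (z : ℂ) : C(AddCircle (1 : ℝ), ℂ) :=
  ∑' j : ℤ, polyGauss Q a (z + p * j) • fourier (-j)

theorem hasSum_zakFourier (Q : Polynomial ℂ) {a : ℝ} (ha : 0 < a) {p : ℕ} (hp : 0 < p) (z : ℂ) :
    HasSum (fun j : ℤ => polyGauss Q a (z + p * j) • (fourier (-j) : C(AddCircle (1 : ℝ), ℂ)))
      (zakFourier Q a p z) := by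
  refine Summable.hasSum (Summable.of_norm ?_)
  refine (summable_norm_zakSum Q ha hp z 0).congr fun j => ?_
  rw [norm_smul, fourier_norm]
  simp

theorem zakFourier_coe (Q : Polynomial ℂ) {a : ℝ} (ha : 0 < a) {p : ℕ} (hp : 0 < p) (z : ℂ)
    (t : ℝ) : zakFourier Q a p z (t : AddCircle (1 : ℝ)) = zakSum Q a p z (-(2 * π * t) : ℝ) := by
  rw [zakFourier, ← ContinuousMap.tsum_apply (hasSum_zakFourier Q ha hp z).summable, zakSum]
  refine tsum_congr fun j => ?_
  rw [ContinuousMap.smul_apply, fourier_coe_apply, smul_eq_mul]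
  congr 2
  push_cast
  ring

theorem fourierCoeff_zakFourier_mul (Q : Polynomial ℂ) {a : ℝ} (ha : 0 < a) {p : ℕ} (hp : 0 < p)
    (z : ℂ) {f : AddCircle (1 : ℝ) → ℂ} (hf : Integrable f AddCircle.haarAddCircle) (m : ℤ) :
    fourierCoeff (fun y => zakFourier Q a p z y * f y) m =
      ∑' j : ℤ, polyGauss Q a (z + p * j - p * m) * fourierCoeff f j := by
  have h1 := ((hasSum_zakFourier Q ha hp z).mul_left (fourier (-m))).mapL
    (integralAgainst AddCircle.haarAddCircle f hf)
  rw [integralAgainst_apply] at h1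
  have h2 : fourierCoeff (fun y => zakFourier Q a p z y * f y) m =
      ∫ y, ((fourier (-m) : C(AddCircle (1 : ℝ), ℂ)) * zakFourier Q a p z) y * f y
        ∂AddCircle.haarAddCircle := by
    simp only [fourierCoeff, smul_eq_mul, ContinuousMap.mul_apply, mul_assoc]
  rw [h2, ← h1.tsum_eq, ← (Equiv.subRight m).tsum_eq]
  refine tsum_congr fun j => ?_
  rw [integralAgainst_apply, fourierCoeff, ← integral_const_mul]
  refine integral_congr_ae (Filter.Eventually.of_forall fun y => ?_)
  have h3 : (fourier (-m) y : ℂ) * fourier (-(j - m)) y = fourier (-j) y := by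
    rw [← fourier_add, show -m + -(j - m) = -j by ring]
  simp only [ContinuousMap.mul_apply, ContinuousMap.smul_apply, smul_eq_mul, Equiv.subRight_apply]
  have h4 : z + p * ((j - m : ℤ) : ℂ) = z + p * j - p * m := by
    push_cast
    ring
  rw [← h3, h4, mul_left_comm, mul_assoc]

/-- Square summable sequences are determined by their pairings with translates of
`polyGauss Q a` when the associated matrices are generically injective. -/
theorem eq_zero_of_tsum_mul_polyGauss {Q : Polynomial ℂ} {a : ℝ} (ha : 0 < a) {p q : ℕ}
    (hp : 0 < p) (hq : 0 < q) {x : ℂ} {Y : Set ℂ} (hY : Y.Countable)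
    (hinj : ∀ ξ ∉ Y, ∀ v, (zakMatrix Q a p q x ξ).mulVec v = 0 → v = 0) {c : ℤ → ℂ}
    (hc : Summable fun n => ‖c n‖ ^ 2)
    (h : ∀ k : ℤ, ∑' n : ℤ, polyGauss Q a (x + n - k * (p / q : ℝ)) * c n = 0) : c = 0 := by
  have : NeZero p := ⟨hp.ne'⟩
  have hmem : ∀ s : Fin p, Memℓp (fun j : ℤ => c (p * j + (s : ℕ))) 2 := by
    intro s
    refine memℓp_gen ?_
    have hi : Function.Injective fun j : ℤ => (p * j + (s : ℕ) : ℤ) := by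
      intro i j hij
      simpa [hp.ne'] using hij
    simpa [Function.comp_def] using hc.comp_injective hi
  let f : Fin p → Lp ℂ 2 (AddCircle.haarAddCircle (T := 1)) := fun s =>
    fourierBasis.repr.symm ⟨_, hmem s⟩
  have hfc : ∀ s j, fourierCoeff (f s) j = c (p * j + (s : ℕ)) := by
    intro s j
    rw [← fourierBasis_repr]
    simp [f]
  have hfi : ∀ s, Integrable (f s) (AddCircle.haarAddCircle (T := 1)) := fun s =>
    (Lp.memLp (f s)).integrable one_le_two
  obtain ⟨C, hC⟩ : ∃ C, ∀ n, ‖c n‖ ≤ C := by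
    refine ⟨Real.sqrt (∑' n, ‖c n‖ ^ 2), fun n => Real.le_sqrt_of_sq_le ?_⟩
    exact hc.le_tsum n fun _ _ => by positivity
  have hsum : ∀ k : ℤ, Summable fun n : ℤ =>
      polyGauss Q a (x + n - k * (p / q : ℝ)) * c n := by
    intro k
    refine Summable.of_norm_bounded
      ((summable_norm_zakSum Q ha one_pos (x - k * (p / q : ℝ)) 0).mul_right C) fun n => ?_
    rw [norm_mul]
    refine mul_le_mul (le_of_eq ?_) (hC n) (norm_nonneg _) (norm_nonneg _)
    simp only [Nat.cast_one, one_mul, mul_zero, zero_mul, Complex.exp_zero, mul_one]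
    congr 2
    ring
  have hG : ∀ r : Fin q, ∀ s : Fin p, Integrable (fun y =>
      zakFourier Q a p (x + (s : ℕ) - (r : ℕ) * (p / q : ℝ)) y * f s y)
        (AddCircle.haarAddCircle (T := 1)) := fun r s =>
    (hfi s).bdd_mul (ContinuousMap.continuous _).aestronglyMeasurable
      (Filter.Eventually.of_forall (ContinuousMap.norm_coe_le_norm _))
  have hzero : ∀ r : Fin q, ∀ᵐ y ∂(AddCircle.haarAddCircle (T := 1)),
      ∑ s : Fin p, zakFourier Q a p (x + (s : ℕ) - (r : ℕ) * (p / q : ℝ)) y * f s y = 0 := by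
    intro r
    refine ae_eq_zero_of_fourierCoeff_eq_zero (integrable_finsetSum _ fun s _ => hG r s)
      fun m => ?_
    have h1 : fourierCoeff (fun y => ∑ s : Fin p,
        zakFourier Q a p (x + (s : ℕ) - (r : ℕ) * (p / q : ℝ)) y * f s y) m =
        ∑ s : Fin p, fourierCoeff (fun y =>
          zakFourier Q a p (x + (s : ℕ) - (r : ℕ) * (p / q : ℝ)) y * f s y) m := by
      simp only [fourierCoeff, smul_eq_mul, Finset.mul_sum]
      refine integral_finsetSum _ fun s _ => (hG r s).bdd_mul (c := 1)
        (ContinuousMap.continuous _).aestronglyMeasurable (Filter.Eventually.of_forall fun y => ?_)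
      exact (ContinuousMap.norm_coe_le_norm _ y).trans (fourier_norm _).le
    rw [h1, ← h (q * m + (r : ℕ)), tsum_int_eq_sum_fin (p := p) (hsum _)]
    refine Finset.sum_congr rfl fun s _ => ?_
    rw [fourierCoeff_zakFourier_mul Q ha hp _ (hfi s)]
    refine tsum_congr fun j => ?_
    rw [hfc]
    congr 2
    have : (q : ℂ) ≠ 0 := by exact_mod_cast hq.ne'
    push_cast
    field_simp
    ring
  have hzero' : ∀ᵐ t : ℝ ∂(volume.restrict (Set.Ioc (0 : ℝ) 1)),
      ∀ s, f s (t : AddCircle (1 : ℝ)) = 0 := by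
    have h1 : ∀ᵐ y ∂(volume : Measure (AddCircle (1 : ℝ))), ∀ r : Fin q,
        ∑ s : Fin p, zakFourier Q a p (x + (s : ℕ) - (r : ℕ) * (p / q : ℝ)) y * f s y = 0 := by
      rw [AddCircle.volume_eq_smul_haarAddCircle]
      exact Measure.ae_smul_measure (ae_all_iff.2 hzero) _
    have h2 := (AddCircle.measurePreserving_mk (1 : ℝ) 0).quasiMeasurePreserving.ae h1
    rw [zero_add] at h2
    have h3 : {t : ℝ | ((-(2 * π * t) : ℝ) : ℂ) ∈ Y}.Countable := by
      refine hY.preimage_of_injOn fun t _ t' _ htt => ?_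
      have := Complex.ofReal_injective htt
      have hpi := Real.pi_pos.ne'
      field_simp at this
      linarith
    filter_upwards [h2, ae_restrict_of_ae (h3.ae_notMem volume)] with t ht htY
    refine fun s => congrFun (hinj _ htY (fun s => f s (t : AddCircle (1 : ℝ))) ?_) s
    funext r
    refine Eq.trans ?_ (ht r)
    simp only [Matrix.mulVec, dotProduct, zakMatrix, Matrix.of_apply, zakFourier_coe Q ha hp]
  funext n
  obtain ⟨⟨j, s⟩, rfl⟩ := (Int.divModEquiv p).symm.surjective n
  have h1 := hfc s j
  have e : (Int.divModEquiv p).symm (j, s) = p * j + (s : ℕ) := by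
    simp [Int.divModEquiv, mul_comm]
  rw [e, ← h1, fourierCoeff_eq_intervalIntegral _ _ 0, zero_add,
    intervalIntegral.integral_of_le zero_le_one]
  rw [integral_congr_ae (g := fun _ => 0)]
  · simp
  · filter_upwards [hzero'] with t ht
    simp [ht s]

theorem ae_summable_norm_comp_add_int {φ : ℝ → ℂ} (hφ : Integrable φ) :
    ∀ᵐ t ∂(volume.restrict (Set.Ioc (0 : ℝ) 1)), Summable fun n : ℤ => ‖φ (t + n)‖ := by
  refine (ae_summable_norm_of_summable_integral_norm
    (fun n : ℤ => (hφ.comp_add_right (n : ℝ)).integrableOn) ?_).2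
  have := hφ.norm.hasSum_intervalIntegral_comp_add_int.summable
  simpa only [intervalIntegral.integral_of_le zero_le_one] using this

theorem memLp_polyGauss (P : Polynomial ℂ) {g : ℝ → ℂ}
    (hg : ∀ x : ℝ, g x = P.eval (x : ℂ) * Complex.exp (-(Real.pi) * x ^ 2)) :
    MemLp g 2 := by
  have hcont : Continuous g := by
    rw [funext hg]
    exact (P.continuous.comp Complex.continuous_ofReal).mul (by fun_prop)
  rw [memLp_two_iff_integrable_sq_norm hcont.aestronglyMeasurable]
  obtain ⟨C, hC, hP⟩ := P.exists_norm_eval_le_mul_exp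
  refine ((integrable_exp_neg_mul_sq (b := 2 * π - 1) (by linarith [Real.pi_gt_three])).const_mul
    (C ^ 2 * Real.exp 1)).mono' (hcont.norm.pow 2).aestronglyMeasurable
      (Filter.Eventually.of_forall fun x => ?_)
  have h1 : ‖g x‖ ≤ C * Real.exp (|x| - π * x ^ 2) := by
    rw [hg, norm_mul, Complex.norm_exp, sub_eq_add_neg, Real.exp_add, ← mul_assoc]
    have h2 := hP x
    rw [Complex.norm_real, Real.norm_eq_abs] at h2
    refine mul_le_mul h2 (le_of_eq ?_) (Real.exp_pos _).le (by positivity)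
    rw [show (-(π : ℂ) * x ^ 2) = ((-(π * x ^ 2) : ℝ) : ℂ) by push_cast; ring, Complex.ofReal_re]
  rw [Real.norm_of_nonneg (by positivity)]
  calc ‖g x‖ ^ 2 ≤ (C * Real.exp (|x| - π * x ^ 2)) ^ 2 := by gcongr
    _ = C ^ 2 * Real.exp (2 * (|x| - π * x ^ 2)) := by
        rw [mul_pow, ← Real.exp_nat_mul]
        norm_num
    _ ≤ C ^ 2 * Real.exp (1 + -(2 * π - 1) * x ^ 2) := by
        gcongr
        nlinarith [sq_nonneg (|x| - 1), sq_abs x]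
    _ = _ := by rw [Real.exp_add]; ring

theorem ae_eq_zero_of_ae_comp_add_int_eq_zero {b : ℝ} (hb : 0 < b) {f : ℝ → ℂ}
    (hf : Integrable fun x => ‖f x‖ ^ 2)
    (h : ∀ᵐ t ∂(volume.restrict (Set.Ioc (0 : ℝ) 1)), ∀ n : ℤ, f (b * (t + n)) = 0) :
    f =ᵐ[volume] 0 := by
  have h1 := (hf.comp_mul_left' hb.ne').hasSum_intervalIntegral_comp_add_int
  have h2 : ∀ n : ℤ, ∫ t in (0 : ℝ)..1, ‖f (b * (t + n))‖ ^ 2 = 0 := by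
    intro n
    rw [intervalIntegral.integral_of_le zero_le_one, integral_congr_ae (g := fun _ => 0)]
    · simp
    · filter_upwards [h] with t ht
      simp [ht n]
  simp only [h2] at h1
  have h3 := h1.unique hasSum_zero
  rw [Measure.integral_comp_mul_left (fun x => ‖f x‖ ^ 2) b, smul_eq_mul, mul_eq_zero] at h3
  have h4 := h3.resolve_left (by positivity)
  rw [integral_eq_zero_iff_of_nonneg (fun _ => by positivity) hf] at h4
  filter_upwards [h4] with x hx
  simpa using hx

theorem stmt_1 (P : Polynomial ℂ) (hP : P ≠ 0)
    (g : ℝ → ℂ) (hg : ∀ x : ℝ, g x = P.eval (x : ℂ) * Complex.exp (-(Real.pi) * x ^ 2))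
    (α β : ℝ) (hα : 0 < α) (hβ : 0 < β)
    (hrat : ∃ r : ℚ, α * β = (r : ℝ)) (hle : α * β ≤ 1) :
    GaborComplete g α β := by
  obtain ⟨r, hr⟩ := hrat
  set p := r.num.natAbs with hp
  set q := r.den with hq
  have hr0 : 0 < r := by
    have : (0 : ℝ) < r := hr ▸ mul_pos hα hβ
    exact_mod_cast this
  have hq0 : 0 < q := r.den_pos
  have hp0 : 0 < p := Int.natAbs_pos.2 (Rat.num_pos.2 hr0).ne'
  have hθ : α * β = p / q := by
    have h1 : (p : ℤ) = r.num := Int.natAbs_of_nonneg (Rat.num_pos.2 hr0).le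
    rw [hr, Rat.cast_def, ← h1, Int.cast_natCast]
  have hpq : p ≤ q := by
    rw [hθ, div_le_one (by positivity)] at hle
    exact_mod_cast hle
  set b : ℝ := β⁻¹ with hb
  have hb0 : 0 < b := by positivity
  set Q : Polynomial ℂ := P.comp (Polynomial.C (b : ℂ) * Polynomial.X) with hQdef
  have hQ : Q ≠ 0 := by
    intro h
    rw [hQdef, Polynomial.comp_eq_zero_iff] at h
    obtain h | ⟨-, h⟩ := h
    · exact hP h
    · have h1 := congrArg (Polynomial.coeff · 1) h
      simp [hb0.ne'] at h1
  have ha : 0 < π * b ^ 2 := by have := Real.pi_pos; positivity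
  have hgQ : ∀ (t : ℝ) (k : ℤ), g (b * t - α * k) =
      polyGauss Q (π * b ^ 2) (t - k * (p / q : ℝ)) := by
    intro t k
    have h1 : b * t - α * k = b * (t - k * (p / q : ℝ)) := by
      rw [← hθ, hb]
      field_simp
    rw [hg, h1, polyGauss, hQdef, Polynomial.eval_comp]
    push_cast
    simp only [Polynomial.eval_mul, Polynomial.eval_C, Polynomial.eval_X]
    congr 2
    ring
  obtain ⟨X, hX, hXinj⟩ := exists_countable_zakMatrix_injective hQ ha hp0 hpq r.reduced
  have hg2 := memLp_polyGauss P hg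
  have hshift : ∀ k : ℤ, MemLp (fun x => g (x - α * k)) 2 := fun k =>
    hg2.comp_measurePreserving (measurePreserving_sub_right volume (α * k))
  rw [GaborComplete, Submodule.topologicalClosure_eq_top_iff, Submodule.eq_bot_iff]
  intro f hf
  have hf2 := Lp.memLp f
  have hfc : MemLp (fun x => starRingEnd ℂ (f x)) 2 := hf2.star
  have h_int : ∀ k : ℤ, Integrable fun x => starRingEnd ℂ (f x) * g (x - α * k) := fun k =>
    hfc.integrable_mul (hshift k)
  have horth : ∀ k l : ℤ, ∫ x : ℝ, Complex.exp (2 * π * I * (β * l * x)) *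
      (starRingEnd ℂ (f x) * g (x - α * k)) = 0 := by
    intro k l
    have hnorm : ∀ x : ℝ, ‖Complex.exp (2 * π * I * (β * l * x))‖ = 1 := by
      intro x
      rw [show (2 * π * I * (β * l * x) : ℂ) = ((2 * π * (β * l * x) : ℝ) : ℂ) * I by
        push_cast; ring]
      exact Complex.norm_exp_ofReal_mul_I _
    have hm : MemLp (fun x : ℝ => Complex.exp (2 * π * I * (β * l * x)) * g (x - α * k)) 2 := by
      refine (hshift k).of_le ((Continuous.aestronglyMeasurable (by fun_prop)).mul (hshift k).1)
        (Filter.Eventually.of_forall fun x => ?_)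
      rw [norm_mul, hnorm, one_mul]
    have h1 := (Submodule.mem_orthogonal' _ _).1 hf hm.toLp
      (Submodule.subset_span ⟨k, l, hm.coeFn_toLp⟩)
    rw [L2.inner_def] at h1
    rw [← h1]
    refine integral_congr_ae ?_
    filter_upwards [hm.coeFn_toLp] with x hx
    rw [hx, RCLike.inner_apply]
    ring
  have hper : ∀ᵐ t ∂(volume.restrict (Set.Ioc (0 : ℝ) 1)), ∀ k : ℤ, ∑' n : ℤ,
      starRingEnd ℂ (f (b * (t + n))) * g (b * (t + n) - α * k) = 0 := by
    refine ae_all_iff.2 fun k => ae_tsum_comp_add_int_eq_zero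
      (φ := fun t => starRingEnd ℂ (f (b * t)) * g (b * t - α * k))
      ((h_int k).comp_mul_left' hb0.ne') fun l => ?_
    have h1 := Measure.integral_comp_mul_left (fun x : ℝ => Complex.exp (2 * π * I * (β * l * x)) *
      (starRingEnd ℂ (f x) * g (x - α * k))) b
    rw [horth k l, smul_zero] at h1
    rw [← h1]
    refine integral_congr_ae (Filter.Eventually.of_forall fun t => ?_)
    have h2 : (β : ℂ) * l * ((b * t : ℝ) : ℂ) = l * t := by
      have : (β : ℂ) ≠ 0 := by exact_mod_cast hβ.ne'
      rw [hb]
      push_cast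
      field_simp
    simp only [h2, mul_assoc]
  have hsq : Integrable fun x => ‖f x‖ ^ 2 := hf2.integrable_norm_pow two_ne_zero
  have hsum : ∀ᵐ t ∂(volume.restrict (Set.Ioc (0 : ℝ) 1)), Summable fun n : ℤ =>
      ‖starRingEnd ℂ (f (b * (t + n)))‖ ^ 2 := by
    have h1 := ae_summable_norm_comp_add_int (φ := fun t => ((‖f (b * t)‖ ^ 2 : ℝ) : ℂ))
      (hsq.comp_mul_left' hb0.ne').ofReal
    filter_upwards [h1] with t ht
    simpa using ht
  rw [Lp.eq_zero_iff_ae_eq_zero]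
  refine ae_eq_zero_of_ae_comp_add_int_eq_zero hb0 hsq ?_
  filter_upwards [hper, hsum, ae_restrict_of_ae
    ((hX.preimage Complex.ofReal_injective).ae_notMem volume)] with t ht hts htX n
  obtain ⟨Y, hY, hinj⟩ := hXinj t htX
  have h0 := eq_zero_of_tsum_mul_polyGauss ha hp0 hq0 hY hinj hts fun k => by
    rw [← ht k]
    refine tsum_congr fun n => ?_
    rw [hgQ (t + n) k, mul_comm]
    push_cast
    rfl
  simpa using congrFun h0 n
end
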